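/- Let Assumption A hold with γ as in (C1). Suppose there is an output map y = h(t,x,u,σ) such that the switched system ẋ = f(t,x,u,σ) is h-OD w.r.t. S with supply function α ∈ K, and the pair (h,f) is zero-input output-persistently exciting (output-PE) w.r.t. S. Then the system is iISS w.r.t. S with iISS gain χ = max{α, γ} and is χ-BEICS w.r.t. S. -/

import Mathlib

open MeasureTheory Set Filter Topology

noncomputable section

/-- A class-`K` function: continuous and strictly increasing on `[0,∞)` with `φ 0 = 0`. -/
def ClassK (φ : ℝ → ℝ) : Prop :=
  ContinuousOn φ (Set.Ici 0) ∧ StrictMonoOn φ (Set.Ici 0) ∧ φ 0 = 0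

/-- A class-`K∞` function: class `K` and unbounded. -/
def ClassKInf (φ : ℝ → ℝ) : Prop :=
  ClassK φ ∧ Filter.Tendsto φ Filter.atTop Filter.atTop

/-- A class-`KL` function: `β (·, t)` is of class `K∞` for each `t ≥ 0` and `β (r, ·)`
decreases monotonically to `0` for each fixed `r ≥ 0`. -/
def ClassKL (β : ℝ → ℝ → ℝ) : Prop :=
  (∀ t, 0 ≤ t → ClassKInf fun r => β r t) ∧
  (∀ r, 0 ≤ r → AntitoneOn (fun t => β r t) (Set.Ici 0) ∧
    Filter.Tendsto (fun t => β r t) Filter.atTop (nhds 0))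

/-- A continuous positive definite function on `[0,∞)`. -/
def PosDefFun (φ : ℝ → ℝ) : Prop :=
  ContinuousOn φ (Set.Ici 0) ∧ φ 0 = 0 ∧ ∀ s, 0 < s → 0 < φ s

variable {Γ : Type*} {E : Type*} {F : Type*} {P : Type*}
  [NormedAddCommGroup E] [NormedSpace ℝ E]
  [NormedAddCommGroup F] [NormedSpace ℝ F]
  [NormedAddCommGroup P]
  [MeasurableSpace E] [MeasurableSpace F] [MeasurableSpace P]

/-- A switching signal: piecewise constant with finitely many discontinuities on every
bounded interval of `[0,∞)`, and right-continuous. -/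
def IsSwitchingSignal (σ : ℝ → Γ) : Prop :=
  ∀ b : ℝ, 0 < b → ∃ (n : ℕ) (t : ℕ → ℝ), t 0 = 0 ∧ (∀ i < n, t i < t (i + 1)) ∧ b ≤ t n ∧
    ∀ i < n, ∀ s ∈ Set.Ico (t i) (t (i + 1)), σ s = σ (t i)

/-- An admissible input: Lebesgue measurable and locally essentially bounded. -/
def IsInput (u : ℝ → F) : Prop :=
  Measurable u ∧ ∀ b : ℝ, ∃ C : ℝ, ∀ᵐ s ∂volume, s ∈ Set.Icc (0 : ℝ) b → ‖u s‖ ≤ C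

/-- A Carathéodory solution of `ẋ = f t x u σ` on the domain `D ⊆ [0,∞)` (an interval):
a continuous function satisfying the corresponding integral equation. -/
structure IsSolution (f : ℝ → E → F → Γ → E) (u : ℝ → F) (σ : ℝ → Γ)
    (D : Set ℝ) (x : ℝ → E) : Prop where
  ordConnected : D.OrdConnected
  subset_Ici : D ⊆ Set.Ici 0
  nonempty : D.Nonempty
  continuousOn : ContinuousOn x D
  intervalIntegrable : ∀ a ∈ D, ∀ b ∈ D,
    IntervalIntegrable (fun s => f s (x s) (u s) (σ s)) volume a b
  integral_eq : ∀ a ∈ D, ∀ b ∈ D, x b = x a + ∫ s in a..b, f s (x s) (u s) (σ s)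

/-- A maximally defined Carathéodory solution: one admitting no proper extension. -/
def IsMaximalSolution (f : ℝ → E → F → Γ → E) (u : ℝ → F) (σ : ℝ → Γ)
    (D : Set ℝ) (x : ℝ → E) : Prop :=
  IsSolution f u σ D x ∧
    ∀ D' : Set ℝ, ∀ x' : ℝ → E, IsSolution f u σ D' x' → D ⊆ D' → Set.EqOn x x' D → D' ⊆ D

/-- Standing regularity assumptions on `f`: vanishing at the origin for zero input,
Lebesgue measurable in `t`, continuous in `(ξ, μ)`. -/
def Regular (f : ℝ → E → F → Γ → E) : Prop :=
  (∀ t, 0 ≤ t → ∀ i, f t 0 0 i = 0) ∧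
  (∀ ξ μ i, Measurable fun t => f t ξ μ i) ∧
  (∀ t i, Continuous fun q : E × F => f t q.1 q.2 i)

/-- Forward completeness w.r.t. `S`. -/
def ForwardComplete (f : ℝ → E → F → Γ → E) (S : Set (ℝ → Γ)) : Prop :=
  ∀ t₀, 0 ≤ t₀ → ∀ u : ℝ → F, IsInput u → ∀ σ ∈ S, ∀ D x,
    IsMaximalSolution f u σ D x → t₀ ∈ D → Set.Ici t₀ ⊆ D

/-- iISS w.r.t. `S` with iISS gain `χ`. -/
def IISS (f : ℝ → E → F → Γ → E) (S : Set (ℝ → Γ)) (χ : ℝ → ℝ) : Prop :=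
  ForwardComplete f S ∧
  ∃ β ρ, ClassKL β ∧ ClassK ρ ∧
    ∀ t₀, 0 ≤ t₀ → ∀ u : ℝ → F, IsInput u → ∀ σ ∈ S, ∀ D x,
      IsMaximalSolution f u σ D x → t₀ ∈ D → ∀ t ∈ D, t₀ ≤ t →
        ‖x t‖ ≤ β ‖x t₀‖ (t - t₀) + ρ (∫ s in t₀..t, χ ‖u s‖)

/-- 0-GUAS w.r.t. `S`. -/
def ZeroGUAS (f : ℝ → E → F → Γ → E) (S : Set (ℝ → Γ)) : Prop :=
  ∃ β, ClassKL β ∧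
    ∀ t₀, 0 ≤ t₀ → ∀ σ ∈ S, ∀ D x,
      IsMaximalSolution f (fun _ => (0 : F)) σ D x → t₀ ∈ D → ∀ t ∈ D, t₀ ≤ t →
        ‖x t‖ ≤ β ‖x t₀‖ (t - t₀)

/-- UBEBS w.r.t. `S` with UBEBS gain `α`. -/
def UBEBS (f : ℝ → E → F → Γ → E) (S : Set (ℝ → Γ)) (α : ℝ → ℝ) : Prop :=
  ∃ α₁ α₂ c, ClassK α₁ ∧ ClassK α₂ ∧ 0 ≤ c ∧
    ∀ t₀, 0 ≤ t₀ → ∀ u : ℝ → F, IsInput u → ∀ σ ∈ S, ∀ D x,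
      IsMaximalSolution f u σ D x → t₀ ∈ D → ∀ t ∈ D, t₀ ≤ t →
        ‖x t‖ ≤ α₁ ‖x t₀‖ + α₂ (∫ s in t₀..t, α ‖u s‖) + c

/-- The total `χ`-energy `∫_0^∞ χ(|u(s)|) ds` of an input, as an extended nonnegative real. -/
def Energy (χ : ℝ → ℝ) (u : ℝ → F) : ENNReal :=
  ∫⁻ s in Set.Ioi (0 : ℝ), ENNReal.ofReal (χ ‖u s‖)

/-- `χ`-BEICS w.r.t. `S`: every solution corresponding to an input of finite `χ`-energy
is defined for all future times and converges to `0`. -/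
def BEICS (f : ℝ → E → F → Γ → E) (S : Set (ℝ → Γ)) (χ : ℝ → ℝ) : Prop :=
  ∀ t₀, 0 ≤ t₀ → ∀ u : ℝ → F, IsInput u → ∀ σ ∈ S, ∀ D x,
    IsMaximalSolution f u σ D x → t₀ ∈ D → Energy χ u ≠ ⊤ →
      Set.Ici t₀ ⊆ D ∧ Filter.Tendsto x Filter.atTop (nhds 0)

/-- Condition (C1) of Assumption A, with the class-`K` function `γ`. -/
def CondC1 (f : ℝ → E → F → Γ → E) (γ : ℝ → ℝ) : Prop :=
  ∃ N : ℝ → ℝ, (∀ r, 0 ≤ r → 0 < N r) ∧ MonotoneOn N (Set.Ici 0) ∧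
    ∀ t, 0 ≤ t → ∀ (ξ : E) (μ : F) (i : Γ), ‖f t ξ μ i‖ ≤ N ‖ξ‖ * (1 + γ ‖μ‖)

/-- Condition (C2) of Assumption A. -/
def CondC2 (f : ℝ → E → F → Γ → E) : Prop :=
  ∀ r, 0 < r → ∀ ε, 0 < ε → ∃ δ, 0 < δ ∧ ∀ t, 0 ≤ t → ∀ (i : Γ) (ξ : E) (μ : F),
    ‖ξ‖ ≤ r → ‖μ‖ ≤ δ → ‖f t ξ μ i - f t ξ 0 i‖ < ε

/-- Condition (C3) of Assumption A: `f (t, ξ, 0, i)` is locally Lipschitz in `ξ`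
uniformly in `t` and `i`. -/
def CondC3 (f : ℝ → E → F → Γ → E) : Prop :=
  ∀ K : Set E, IsCompact K → ∃ L, 0 ≤ L ∧ ∀ t, 0 ≤ t → ∀ (i : Γ), ∀ ξ ∈ K, ∀ ξ' ∈ K,
    ‖f t ξ 0 i - f t ξ' 0 i‖ ≤ L * ‖ξ - ξ'‖

/-- Assumption A, with `γ` the class-`K` function appearing in (C1). -/
def AssumptionA (f : ℝ → E → F → Γ → E) (γ : ℝ → ℝ) : Prop :=
  ClassK γ ∧ CondC1 f γ ∧ CondC2 f ∧ CondC3 f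

/-- Sandwich bounds `φ₁(|ξ|) ≤ V(t,ξ) ≤ φ₂(|ξ|)` with `φ₁, φ₂` of class `K∞`. -/
def StorageBounds (V : ℝ → E → ℝ) : Prop :=
  ∃ φ₁ φ₂, ClassKInf φ₁ ∧ ClassKInf φ₂ ∧
    ∀ t, 0 ≤ t → ∀ ξ : E, φ₁ ‖ξ‖ ≤ V t ξ ∧ V t ξ ≤ φ₂ ‖ξ‖

/-- 0-OD (zero-output dissipativity) w.r.t. `S` witnessed by the storage function `V`
and the supply function `α`. -/
def ZeroODWithStorage (f : ℝ → E → F → Γ → E) (S : Set (ℝ → Γ)) (V : ℝ → E → ℝ)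
    (α : ℝ → ℝ) : Prop :=
  StorageBounds V ∧
    ∀ t₀, 0 ≤ t₀ → ∀ u : ℝ → F, IsInput u → ∀ σ ∈ S, ∀ D x,
      IsMaximalSolution f u σ D x → t₀ ∈ D → ∀ t ∈ D, t₀ ≤ t →
        V t (x t) ≤ V t₀ (x t₀) + ∫ s in t₀..t, α ‖u s‖

/-- 0-OD w.r.t. `S` with supply function `α`. -/
def ZeroOD (f : ℝ → E → F → Γ → E) (S : Set (ℝ → Γ)) (α : ℝ → ℝ) : Prop :=
  ∃ V : ℝ → E → ℝ, (∀ t ξ, 0 ≤ V t ξ) ∧ ZeroODWithStorage f S V α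

/-- `h`-OD (output dissipativity) w.r.t. `S` with supply function `α`. -/
def HOD (f : ℝ → E → F → Γ → E) (h : ℝ → E → F → Γ → P) (S : Set (ℝ → Γ))
    (α : ℝ → ℝ) : Prop :=
  ∃ V : ℝ → E → ℝ, (∀ t ξ, 0 ≤ V t ξ) ∧ StorageBounds V ∧
    ∃ α₃, PosDefFun α₃ ∧
      ∀ t₀, 0 ≤ t₀ → ∀ u : ℝ → F, IsInput u → ∀ σ ∈ S, ∀ D x,
        IsMaximalSolution f u σ D x → t₀ ∈ D → ∀ t ∈ D, t₀ ≤ t →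
          V t (x t) ≤ V t₀ (x t₀) - (∫ s in t₀..t, α₃ ‖h s (x s) (u s) (σ s)‖)
            + ∫ s in t₀..t, α ‖u s‖

/-- The pair `(h, f)` is zero-input output-persistently exciting w.r.t. `S`. -/
def OutputPE (f : ℝ → E → F → Γ → E) (h : ℝ → E → F → Γ → P)
    (S : Set (ℝ → Γ)) : Prop :=
  ∀ ε : ℝ, 0 < ε → ε ≤ 1 → ∃ T, 0 < T ∧ ∃ r, 0 < r ∧
    ∀ t₀, 0 ≤ t₀ → ∀ σ ∈ S, ∀ D x,
      IsMaximalSolution f (fun _ => (0 : F)) σ D x → t₀ ∈ D →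
        ∀ t, t₀ ≤ t → Set.Icc t (t + T) ⊆ D →
          (∀ τ ∈ Set.Icc t (t + T), ε ≤ ‖x τ‖ ∧ ‖x τ‖ ≤ 1 / ε) →
            r ≤ ∫ τ in t..(t + T), ‖h τ (x τ) 0 (σ τ)‖ ^ 2

/-- Standing regularity assumptions on the output map `h`. -/
def OutputRegular (h : ℝ → E → F → Γ → P) : Prop :=
  (∀ ξ μ i, Measurable fun t => h t ξ μ i) ∧
  (∀ t i, Continuous fun q : E × F => h t q.1 q.2 i) ∧
  ∀ K : Set E, IsCompact K → (0 : E) ∉ K → ∃ M : ℝ,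
    ∀ᵐ t ∂volume, 0 ≤ t → ∀ ξ ∈ K, ∀ i : Γ, ‖h t ξ 0 i‖ ≤ M

set_option linter.unusedSectionVars false

section Measurability

theorem intervalIntegrable_of_ae_norm_le {Q : Type*} [NormedAddCommGroup Q] {g : ℝ → Q}
    {a b C : ℝ} (hab : a ≤ b) (hg : AEStronglyMeasurable g (volume.restrict (Icc a b)))
    (hC : ∀ᵐ s ∂volume, s ∈ Icc a b → ‖g s‖ ≤ C) : IntervalIntegrable g volume a b := by
  rw [intervalIntegrable_iff_integrableOn_Icc_of_le hab]
  have hfin : IsFiniteMeasure (volume.restrict (Icc a b)) := ⟨by simp⟩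
  exact Integrable.of_bound hg C ((ae_restrict_iff' measurableSet_Icc).2 hC)

theorem aemeasurable_comp_norm {Q : Type*} [NormedAddCommGroup Q] [MeasurableSpace Q]
    [OpensMeasurableSpace Q] {φ : ℝ → ℝ} (hφ : ContinuousOn φ (Ici 0)) {v : ℝ → Q}
    {μ : Measure ℝ} (hv : AEMeasurable v μ) : AEMeasurable (fun s => φ ‖v s‖) μ := by
  have hc : Continuous fun s => φ (max 0 s) :=
    hφ.comp_continuous (by fun_prop) fun s => mem_Ici.2 (le_max_left _ _)
  have := hc.measurable.comp_aemeasurable hv.norm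
  refine this.congr (ae_of_all _ fun s => ?_)
  simp

theorem IsInput.intervalIntegrable [OpensMeasurableSpace F] {u : ℝ → F} (hu : IsInput u)
    {φ : ℝ → ℝ} (hφ : ContinuousOn φ (Ici 0)) {a b : ℝ} (ha : 0 ≤ a) (hab : a ≤ b) :
    IntervalIntegrable (fun s => φ ‖u s‖) volume a b := by
  obtain ⟨C, hC⟩ := hu.2 b
  obtain ⟨M, hM⟩ := (isCompact_Icc (a := (0 : ℝ)) (b := C)).exists_bound_of_continuousOn
    (hφ.mono Icc_subset_Ici_self)
  refine intervalIntegrable_of_ae_norm_le (C := M) hab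
    (aemeasurable_comp_norm hφ hu.1.aemeasurable).aestronglyMeasurable ?_
  filter_upwards [hC] with s hs hsI
  exact hM _ ⟨norm_nonneg _, hs ⟨ha.trans hsI.1, hsI.2⟩⟩

theorem isInput_zero : IsInput (fun _ : ℝ => (0 : F)) :=
  ⟨measurable_const, fun _ => ⟨0, by simp⟩⟩

theorem IsSwitchingSignal.measurable_comp {Q : Type*} [MeasurableSpace Q] {σ : ℝ → Γ}
    (hσ : IsSwitchingSignal σ) {φ : ℝ → Γ → Q} (hφ : ∀ i, Measurable fun t => φ t i) :
    Measurable fun t => φ t (σ (max 0 t)) := by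
  intro s hs
  have key : ∀ N : ℕ, MeasurableSet ((fun t => φ t (σ (max 0 t))) ⁻¹' s ∩ Iio (N : ℝ)) := by
    intro N
    obtain ⟨n, t, ht0, hmono, hb, hconst⟩ := hσ (N + 1) (by positivity)
    have step : ∀ k ≤ n, MeasurableSet ((fun t => φ t (σ (max 0 t))) ⁻¹' s ∩ Iio (t k)) ∧
        0 ≤ t k := by
      intro k
      induction k with
      | zero =>
        intro _
        rw [ht0]
        refine ⟨?_, le_rfl⟩
        have : (fun t => φ t (σ (max 0 t))) ⁻¹' s ∩ Iio (0 : ℝ)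
            = (fun t => φ t (σ 0)) ⁻¹' s ∩ Iio 0 := by
          ext r
          simp only [mem_inter_iff, mem_preimage, mem_Iio, and_congr_left_iff]
          intro hr
          rw [max_eq_left hr.le]
        rw [this]
        exact (hφ _ hs).inter measurableSet_Iio
      | succ k ih =>
        intro hk
        obtain ⟨ihm, ih0⟩ := ih (by omega)
        have hlt := hmono k (by omega)
        refine ⟨?_, ih0.trans hlt.le⟩
        have : (fun t => φ t (σ (max 0 t))) ⁻¹' s ∩ Iio (t (k + 1))
            = ((fun t => φ t (σ (max 0 t))) ⁻¹' s ∩ Iio (t k)) ∪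
              ((fun r => φ r (σ (t k))) ⁻¹' s ∩ Ico (t k) (t (k + 1))) := by
          rw [← Iio_union_Ico_eq_Iio hlt.le, inter_union_distrib_left]
          congr 1
          ext r
          simp only [mem_inter_iff, mem_preimage, and_congr_left_iff]
          intro hr
          rw [max_eq_right (ih0.trans hr.1), hconst k (by omega) r hr]
        rw [this]
        exact ihm.union ((hφ _ hs).inter measurableSet_Ico)
    have : (fun t => φ t (σ (max 0 t))) ⁻¹' s ∩ Iio (N : ℝ)
        = ((fun t => φ t (σ (max 0 t))) ⁻¹' s ∩ Iio (t n)) ∩ Iio (N : ℝ) := by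
      rw [inter_assoc, Iio_inter_Iio, min_eq_right (by linarith)]
    rw [this]
    exact (step n le_rfl).1.inter measurableSet_Iio
  have : (fun t => φ t (σ (max 0 t))) ⁻¹' s
      = ⋃ N : ℕ, ((fun t => φ t (σ (max 0 t))) ⁻¹' s ∩ Iio (N : ℝ)) := by
    rw [← inter_iUnion]
    have : ⋃ N : ℕ, Iio (N : ℝ) = univ :=
      eq_univ_of_forall fun r => mem_iUnion.2 (exists_nat_gt r)
    rw [this, inter_univ]
  rw [this]
  exact MeasurableSet.iUnion key

theorem IsSwitchingSignal.measurable_uncurry [BorelSpace E] [SecondCountableTopology E]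
    [BorelSpace F] [SecondCountableTopology F] {Q : Type*} [NormedAddCommGroup Q]
    [MeasurableSpace Q] [BorelSpace Q] {σ : ℝ → Γ} (hσ : IsSwitchingSignal σ)
    {G : ℝ → E → F → Γ → Q} (hGm : ∀ ξ μ i, Measurable fun t => G t ξ μ i)
    (hGc : ∀ t i, Continuous fun q : E × F => G t q.1 q.2 i) :
    Measurable (Function.uncurry fun (q : E × F) t => G t q.1 q.2 (σ (max 0 t))) :=
  measurable_uncurry_of_continuous_of_measurable (fun t => hGc t _)
    fun q => hσ.measurable_comp fun i => hGm q.1 q.2 i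

/-- Along a measurable curve and a measurable input, a switched map that is measurable in time
and continuous in the remaining arguments is measurable. -/
theorem IsSwitchingSignal.aemeasurable_comp [BorelSpace E] [SecondCountableTopology E]
    [BorelSpace F] [SecondCountableTopology F] {Q : Type*} [NormedAddCommGroup Q]
    [MeasurableSpace Q] [BorelSpace Q] {σ : ℝ → Γ} (hσ : IsSwitchingSignal σ)
    {G : ℝ → E → F → Γ → Q} (hGm : ∀ ξ μ i, Measurable fun t => G t ξ μ i)
    (hGc : ∀ t i, Continuous fun q : E × F => G t q.1 q.2 i) {A : Set ℝ}
    (hA : MeasurableSet A) (hA0 : A ⊆ Ici 0) {x : ℝ → E}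
    (hx : AEMeasurable x (volume.restrict A)) {v : ℝ → F} (hv : Measurable v) :
    AEMeasurable (fun s => G s (x s) (v s) (σ s)) (volume.restrict A) := by
  have := (hσ.measurable_uncurry hGm hGc).comp_aemeasurable ((hx.prodMk hv.aemeasurable).prodMk aemeasurable_id)
  refine this.congr ?_
  filter_upwards [ae_restrict_mem hA] with s hs
  simp [Function.uncurry, max_eq_right (mem_Ici.1 (hA0 hs))]

end Measurability

section Peano

variable [BorelSpace E] [ProperSpace E]

/-- Solutions of the delayed integral equation used to approximate a solution of
`y t = ξ₀ + ∫ s in a..t, G s (y s)`. -/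
theorem exists_delayed_solution {G : ℝ → E → E} (hGm : ∀ ξ, Measurable fun t => G t ξ)
    (hGc : ∀ t, Continuous (G t)) {M : ℝ} (hM : ∀ t ξ, ‖G t ξ‖ ≤ M) (a b : ℝ) (ξ₀ : E) {d : ℝ}
    (hd : 0 < d) :
    ∃ y : ℝ → E, (∀ s t, ‖y s - y t‖ ≤ M * |s - t|) ∧
      ∀ t ≤ b, y t = ξ₀ + ∫ s in a..max a (t - d), G s (y s) := by
  have hM0 : 0 ≤ M := (norm_nonneg _).trans (hM 0 0)
  have hcomp : ∀ y : ℝ → E, Continuous y → ∀ p q,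
      IntervalIntegrable (fun s => G s (y s)) volume p q := by
    intro y hy p q
    have hm : Measurable (Function.uncurry fun (ξ : E) t => G t ξ) :=
      measurable_uncurry_of_continuous_of_measurable hGc hGm
    have hm' : Measurable fun s => G s (y s) := hm.comp (hy.measurable.prodMk measurable_id)
    rw [intervalIntegrable_iff]
    have hfin : IsFiniteMeasure (volume.restrict (uIoc p q)) := ⟨by simp [uIoc]⟩
    exact Integrable.of_bound hm'.aestronglyMeasurable M (ae_of_all _ fun s => hM _ _)
  let Φ : (ℝ → E) → ℝ → E := fun y t => ξ₀ + ∫ s in a..max a (t - d), G s (y s)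
  have hΦ : ∀ y, Continuous y → ∀ s t, ‖Φ y s - Φ y t‖ ≤ M * |s - t| := by
    intro y hy s t
    have h1 : Φ y s - Φ y t = ∫ r in max a (t - d)..max a (s - d), G r (y r) := by
      simp only [Φ, add_sub_add_left_eq_sub]
      exact intervalIntegral.integral_interval_sub_left (hcomp y hy _ _) (hcomp y hy _ _)
    rw [h1]
    refine (intervalIntegral.norm_integral_le_of_norm_le_const fun r _ => hM _ _).trans ?_
    refine mul_le_mul_of_nonneg_left ?_ hM0
    have := abs_max_sub_max_le_max a (s - d) a (t - d)
    simpa using this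
  have hcont : ∀ y : ℝ → E, (∀ s t, ‖y s - y t‖ ≤ M * |s - t|) → Continuous y := by
    intro y hy
    refine (LipschitzWith.of_dist_le_mul (K := ⟨M, hM0⟩) fun s t => ?_).continuous
    rw [dist_eq_norm, Real.dist_eq]
    exact hy s t
  let Y : ℕ → ℝ → E := fun j => Φ^[j] fun _ => ξ₀
  have hYs : ∀ j, Y (j + 1) = Φ (Y j) := fun j => Function.iterate_succ_apply' _ _ _
  have hYl : ∀ j s t, ‖Y j s - Y j t‖ ≤ M * |s - t| := by
    intro j
    induction j with
    | zero =>
      intro s t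
      simp only [Y, Function.iterate_zero, id, sub_self, norm_zero]
      positivity
    | succ j ih =>
      rw [hYs]
      exact hΦ _ (hcont _ ih)
  have hYe : ∀ j : ℕ, ∀ t ≤ a + j * d, Y (j + 1) t = Y j t := by
    intro j
    induction j with
    | zero =>
      intro t ht
      have : max a (t - d) = a := max_eq_left (by simp at ht; linarith)
      simp [hYs, Φ, this, Y]
    | succ j ih =>
      intro t ht
      rw [hYs (j + 1)]
      conv_rhs => rw [hYs j]
      simp only [Φ]
      congr 1
      refine intervalIntegral.integral_congr fun s hs => ?_
      rw [uIcc_of_le (le_max_left _ _)] at hs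
      have : Y (j + 1) s = Y j s := by
        refine ih s (hs.2.trans (max_le ?_ ?_))
        · have : 0 ≤ (j : ℝ) * d := by positivity
          linarith
        · push_cast at ht
          linarith
      simp only [this]
  obtain ⟨J, hJ⟩ := exists_nat_ge ((b - a) / d)
  refine ⟨Y J, hYl J, fun t ht => ?_⟩
  rw [← hYe J t, hYs]
  rw [div_le_iff₀ hd] at hJ
  linarith

/-- Carathéodory's existence theorem for a globally bounded right-hand side. -/
theorem exists_integral_solution {G : ℝ → E → E} (hGm : ∀ ξ, Measurable fun t => G t ξ)
    (hGc : ∀ t, Continuous (G t)) {M : ℝ} (hM : ∀ t ξ, ‖G t ξ‖ ≤ M) {a b : ℝ} (hab : a ≤ b)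
    (ξ₀ : E) :
    ∃ y : ℝ → E, Continuous y ∧ IntervalIntegrable (fun s => G s (y s)) volume a b ∧
      ∀ t ∈ Icc a b, y t = ξ₀ + ∫ s in a..t, G s (y s) := by
  have hM0 : 0 ≤ M := (norm_nonneg _).trans (hM 0 0)
  have hm : Measurable (Function.uncurry fun (ξ : E) t => G t ξ) :=
    measurable_uncurry_of_continuous_of_measurable hGc hGm
  have hmeas : ∀ y : ℝ → E, Continuous y → Measurable fun s => G s (y s) := fun y hy =>
    hm.comp (hy.measurable.prodMk measurable_id)
  have hint : ∀ y : ℝ → E, Continuous y → ∀ p q,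
      IntervalIntegrable (fun s => G s (y s)) volume p q := by
    intro y hy p q
    rw [intervalIntegrable_iff]
    have hfin : IsFiniteMeasure (volume.restrict (uIoc p q)) := ⟨by simp [uIoc]⟩
    exact Integrable.of_bound (hmeas y hy).aestronglyMeasurable M (ae_of_all _ fun s => hM _ _)
  choose z hzl hze using fun k : ℕ =>
    exists_delayed_solution hGm hGc hM a b ξ₀ (d := 1 / ((k : ℝ) + 1)) (by positivity)
  have hLip : ∀ k, LipschitzWith ⟨M, hM0⟩ (z k) := by
    intro k
    refine LipschitzWith.of_dist_le_mul fun s t => ?_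
    rw [dist_eq_norm, Real.dist_eq]
    exact hzl k s t
  let A : Set (BoundedContinuousFunction (Icc a b) E) :=
    {w | (∀ s, w s ∈ Metric.closedBall ξ₀ (M * (b - a))) ∧ LipschitzWith ⟨M, hM0⟩ w}
  let w : ℕ → BoundedContinuousFunction (Icc a b) E := fun k =>
    BoundedContinuousFunction.mkOfCompact
      ⟨fun s => z k s, (hLip k).continuous.comp continuous_subtype_val⟩
  have hw : ∀ k s, w k s = z k s := fun _ _ => rfl
  have hza : ∀ k, z k a = ξ₀ := by
    intro k
    have : (0 : ℝ) ≤ 1 / ((k : ℝ) + 1) := by positivity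
    rw [hze k a hab, max_eq_left (by linarith)]
    simp
  have hwA : ∀ k, w k ∈ A := by
    intro k
    refine ⟨fun s => ?_, ?_⟩
    · rw [hw, mem_closedBall_iff_norm]
      have := hzl k s a
      rw [hza] at this
      refine this.trans ?_
      gcongr
      rw [abs_of_nonneg (by linarith [s.2.1])]
      linarith [s.2.2]
    · exact LipschitzWith.of_dist_le_mul fun s t => (hLip k).dist_le_mul s t
  have hcpt : IsCompact (closure A) := by
    refine BoundedContinuousFunction.arzela_ascoli (Metric.closedBall ξ₀ (M * (b - a)))
      (isCompact_closedBall _ _) A (fun f s hf => hf.1 s) ?_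
    exact (LipschitzWith.uniformEquicontinuous _ ⟨M, hM0⟩ fun f => f.2.2).equicontinuous
  obtain ⟨wl, -, φ, hφ, hlim⟩ := hcpt.tendsto_subseq fun k => subset_closure (hwA k)
  let y : ℝ → E := IccExtend hab wl
  have hy : Continuous y := wl.continuous.Icc_extend'
  have hptw : ∀ s ∈ Icc a b, Tendsto (fun k => z (φ k) s) atTop (𝓝 (y s)) := by
    intro s hs
    have h1 := (BoundedContinuousFunction.tendsto_iff_tendstoUniformly.1 hlim).tendsto_at ⟨s, hs⟩
    simp only [y, IccExtend_of_mem hab wl hs]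
    exact h1
  refine ⟨y, hy, hint y hy _ _, fun t ht => ?_⟩
  have hsub : uIoc a t ⊆ Icc a b := by
    rw [uIoc_of_le ht.1]
    exact fun s hs => ⟨hs.1.le, hs.2.trans ht.2⟩
  have hI : Tendsto (fun k => ∫ s in a..t, G s (z (φ k) s)) atTop
      (𝓝 (∫ s in a..t, G s (y s))) := by
    refine intervalIntegral.tendsto_integral_filter_of_dominated_convergence (fun _ => M)
      (Eventually.of_forall fun k => (hmeas _ (hLip _).continuous).aestronglyMeasurable)
      (Eventually.of_forall fun k => ae_of_all _ fun s _ => hM _ _) (by simp)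
      (ae_of_all _ fun s hs => ?_)
    exact ((hGc s).tendsto _).comp (hptw s (hsub hs))
  have hd : Tendsto (fun k => 1 / ((φ k : ℝ) + 1)) atTop (𝓝 0) :=
    tendsto_one_div_add_atTop_nhds_zero_nat.comp hφ.tendsto_atTop
  have hR : Tendsto (fun k => ∫ s in t..max a (t - 1 / ((φ k : ℝ) + 1)), G s (z (φ k) s)) atTop
      (𝓝 0) := by
    refine squeeze_zero_norm (a := fun k => M * (1 / ((φ k : ℝ) + 1))) (fun k => ?_)
      (by simpa using hd.const_mul M)
    refine (intervalIntegral.norm_integral_le_of_norm_le_const fun s _ => hM _ _).trans ?_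
    have h0 : (0 : ℝ) ≤ 1 / ((φ k : ℝ) + 1) := by positivity
    gcongr
    rw [abs_le]
    constructor
    · linarith [le_max_right a (t - 1 / ((φ k : ℝ) + 1))]
    · have : max a (t - 1 / ((φ k : ℝ) + 1)) ≤ t := max_le ht.1 (by linarith)
      linarith
  have hsum := (hI.add hR).const_add ξ₀
  rw [add_zero] at hsum
  refine tendsto_nhds_unique (hptw t ht) (hsum.congr fun k => ?_)
  rw [hze (φ k) t ht.2, intervalIntegral.integral_add_adjacent_intervals
    (hint _ (hLip _).continuous _ _) (hint _ (hLip _).continuous _ _)]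

end Peano

section Solutions

theorem continuousOn_of_continuousOn_Icc {Q : Type*} [TopologicalSpace Q] {D : Set ℝ}
    {x : ℝ → Q} (h : ∀ a ∈ D, ∀ b ∈ D, a ≤ b → ContinuousOn x (Icc a b)) :
    ContinuousOn x D := by
  intro t ht
  have hl : ContinuousWithinAt x (D ∩ Iic t) t := by
    by_cases hex : ∃ a ∈ D, a < t
    · obtain ⟨a, ha, hat⟩ := hex
      refine (h a ha t ht hat.le t (right_mem_Icc.2 hat.le)).mono_of_mem_nhdsWithin ?_
      filter_upwards [mem_nhdsWithin_of_mem_nhds (Ioi_mem_nhds hat), self_mem_nhdsWithin]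
        with s hs hs'
      exact ⟨le_of_lt hs, hs'.2⟩
    · push Not at hex
      exact continuousWithinAt_singleton.mono fun s hs => le_antisymm hs.2 (hex s hs.1)
  have hr : ContinuousWithinAt x (D ∩ Ici t) t := by
    by_cases hex : ∃ a ∈ D, t < a
    · obtain ⟨a, ha, hat⟩ := hex
      refine (h t ht a ha hat.le t (left_mem_Icc.2 hat.le)).mono_of_mem_nhdsWithin ?_
      filter_upwards [mem_nhdsWithin_of_mem_nhds (Iio_mem_nhds hat), self_mem_nhdsWithin]
        with s hs hs'
      exact ⟨hs'.2, le_of_lt hs⟩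
    · push Not at hex
      exact continuousWithinAt_singleton.mono fun s hs => le_antisymm (hex s hs.1) hs.2
  refine (hl.union hr).mono fun s hs => ?_
  rcases le_total s t with hst | hst
  · exact Or.inl ⟨hs, hst⟩
  · exact Or.inr ⟨hs, hst⟩

variable {f : ℝ → E → F → Γ → E} {u : ℝ → F} {σ : ℝ → Γ} {D : Set ℝ} {x : ℝ → E}

theorem IsSolution.of_base {t₀ : ℝ} (hD : D.OrdConnected) (hD0 : D ⊆ Ici 0) (ht₀ : t₀ ∈ D)
    (hint : ∀ a ∈ D, IntervalIntegrable (fun s => f s (x s) (u s) (σ s)) volume t₀ a)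
    (heq : ∀ a ∈ D, x a = x t₀ + ∫ s in t₀..a, f s (x s) (u s) (σ s)) :
    IsSolution f u σ D x := by
  have hint' : ∀ a ∈ D, ∀ b ∈ D,
      IntervalIntegrable (fun s => f s (x s) (u s) (σ s)) volume a b := fun a ha b hb =>
    (hint a ha).symm.trans (hint b hb)
  have heq' : ∀ a ∈ D, ∀ b ∈ D, x b = x a + ∫ s in a..b, f s (x s) (u s) (σ s) := by
    intro a ha b hb
    rw [heq b hb, heq a ha, add_assoc,
      intervalIntegral.integral_add_adjacent_intervals (hint a ha) (hint' a ha b hb)]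
  refine ⟨hD, hD0, ⟨t₀, ht₀⟩, continuousOn_of_continuousOn_Icc fun a ha b hb hab => ?_, hint', heq'⟩
  have hc := intervalIntegral.continuousOn_primitive_interval' (hint' a ha b hb) left_mem_uIcc
  rw [uIcc_of_le hab] at hc
  exact (continuousOn_const.add hc).congr fun t ht => heq' a ha t (hD.out ha hb ht)

theorem IsSolution.exists_maximal (hx : IsSolution f u σ D x) :
    ∃ D' x', IsMaximalSolution f u σ D' x' ∧ D ⊆ D' ∧ EqOn x x' D := by
  classical
  let X := {p : Set ℝ × (ℝ → E) // IsSolution f u σ p.1 p.2 ∧ D ⊆ p.1 ∧ EqOn x p.2 D}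
  let r : X → X → Prop := fun p q => p.1.1 ⊆ q.1.1 ∧ EqOn p.1.2 q.1.2 p.1.1
  have hchain : ∀ c : Set X, IsChain r c → ∃ ub, ∀ a ∈ c, r a ub := by
    intro c hc
    rcases c.eq_empty_or_nonempty with rfl | ⟨p₀, hp₀⟩
    · exact ⟨⟨(D, x), hx, Subset.rfl, fun _ _ => rfl⟩, by simp⟩
    have htot : ∀ p ∈ c, ∀ q ∈ c, r p q ∨ r q p := by
      intro p hp q hq
      by_cases hpq : p = q
      · subst hpq
        exact Or.inl ⟨Subset.rfl, fun _ _ => rfl⟩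
      · exact hc hp hq hpq
    let U : Set ℝ := {t | ∃ p ∈ c, t ∈ p.1.1}
    let y : ℝ → E := fun t => if ht : ∃ p ∈ c, t ∈ p.1.1 then (Classical.choose ht).1.2 t else 0
    have hy : ∀ p ∈ c, EqOn p.1.2 y p.1.1 := by
      intro p hp t ht
      have hex : ∃ p ∈ c, t ∈ p.1.1 := ⟨p, hp, ht⟩
      obtain ⟨hq, hqt⟩ := Classical.choose_spec hex
      simp only [y, dif_pos hex]
      rcases htot p hp _ hq with h | h
      · exact h.2 ht
      · exact (h.2 hqt).symm
    have hpU : ∀ p ∈ c, p.1.1 ⊆ U := fun p hp t ht => ⟨p, hp, ht⟩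
    have hcommon : ∀ a ∈ U, ∀ b ∈ U, ∃ p ∈ c, a ∈ p.1.1 ∧ b ∈ p.1.1 := by
      rintro a ⟨p, hp, ha⟩ b ⟨q, hq, hb⟩
      rcases htot p hp q hq with h | h
      · exact ⟨q, hq, h.1 ha, hb⟩
      · exact ⟨p, hp, ha, h.1 hb⟩
    obtain ⟨t₀, ht₀⟩ := hx.nonempty
    have ht₀U : t₀ ∈ U := ⟨p₀, hp₀, p₀.2.2.1 ht₀⟩
    have hrhs : ∀ p ∈ c, ∀ a ∈ p.1.1, ∀ b ∈ p.1.1,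
        EqOn (fun s => f s (p.1.2 s) (u s) (σ s)) (fun s => f s (y s) (u s) (σ s)) (uIcc a b) := by
      intro p hp a ha b hb s hs
      simp only [hy p hp (p.2.1.ordConnected.uIcc_subset ha hb hs)]
    have hsol : IsSolution f u σ U y := by
      refine IsSolution.of_base (t₀ := t₀) ⟨fun a ha b hb => ?_⟩ ?_ ht₀U (fun a ha => ?_)
        fun a ha => ?_
      · obtain ⟨p, hp, hpa, hpb⟩ := hcommon a ha b hb
        exact (p.2.1.ordConnected.out hpa hpb).trans (hpU p hp)
      · rintro t ⟨p, -, ht⟩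
        exact p.2.1.subset_Ici ht
      · obtain ⟨p, hp, hpa, hpb⟩ := hcommon t₀ ht₀U a ha
        exact (p.2.1.intervalIntegrable t₀ hpa a hpb).congr
          ((hrhs p hp t₀ hpa a hpb).mono uIoc_subset_uIcc)
      · obtain ⟨p, hp, hpa, hpb⟩ := hcommon t₀ ht₀U a ha
        rw [← hy p hp hpa, ← hy p hp hpb, p.2.1.integral_eq t₀ hpa a hpb,
          intervalIntegral.integral_congr (hrhs p hp t₀ hpa a hpb)]
    refine ⟨⟨(U, y), hsol, fun t ht => ⟨p₀, hp₀, p₀.2.2.1 ht⟩, fun t ht => ?_⟩,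
      fun p hp => ⟨hpU p hp, hy p hp⟩⟩
    exact (p₀.2.2.2 ht).trans (hy p₀ hp₀ (p₀.2.2.1 ht))
  obtain ⟨m, hm⟩ := exists_maximal_of_chains_bounded hchain
    fun {a b c} hab hbc => ⟨hab.1.trans hbc.1, fun t ht => (hab.2 ht).trans (hbc.2 (hab.1 ht))⟩
  refine ⟨m.1.1, m.1.2, ⟨m.2.1, fun D' x' hx' hD' heq => ?_⟩, m.2.2.1, m.2.2.2⟩
  exact (hm ⟨(D', x'), hx', m.2.2.1.trans hD',
    fun t ht => (m.2.2.2 ht).trans (heq (m.2.2.1 ht))⟩ ⟨hD', heq⟩).1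

theorem IsSolution.glue_right {b c : ℝ} {y : ℝ → E} (hx : IsSolution f u σ D x) (hb : b ∈ D)
    (hDb : ∀ s ∈ D, s ≤ b) (hbc : b ≤ c) (hy : IsSolution f u σ (Icc b c) y) (hyb : y b = x b) :
    IsSolution f u σ (D ∪ Icc b c) fun t => if t ≤ b then x t else y t := by
  set z : ℝ → E := fun t => if t ≤ b then x t else y t with hz
  have hzx : ∀ s ≤ b, z s = x s := fun s hs => if_pos hs
  have hzy : ∀ s, b ≤ s → z s = y s := by
    intro s hs
    rcases hs.eq_or_lt with rfl | h
    · rw [hzx _ le_rfl, hyb]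
    · exact if_neg (not_le.2 h)
  have hb' : b ∈ Icc b c := left_mem_Icc.2 hbc
  have hl : ∀ a ∈ D, EqOn (fun s => f s (x s) (u s) (σ s)) (fun s => f s (z s) (u s) (σ s))
      (uIcc b a) := by
    intro a ha s hs
    rw [uIcc_of_ge (hDb a ha)] at hs
    simp only [hzx s hs.2]
  have hr : ∀ a ∈ Icc b c, EqOn (fun s => f s (y s) (u s) (σ s))
      (fun s => f s (z s) (u s) (σ s)) (uIcc b a) := by
    intro a ha s hs
    rw [uIcc_of_le ha.1] at hs
    simp only [hzy s hs.1]
  refine IsSolution.of_base (t₀ := b) ⟨?_⟩ (union_subset hx.subset_Ici hy.subset_Ici)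
    (Or.inl hb) ?_ ?_
  · rintro p hp q hq s hs
    rcases le_total s b with h | h
    · rcases hp with hp | hp
      · exact Or.inl (hx.ordConnected.out hp hb ⟨hs.1, h⟩)
      · exact Or.inr ⟨hp.1.trans hs.1, h.trans hbc⟩
    · refine Or.inr ⟨h, hs.2.trans ?_⟩
      rcases hq with hq | hq
      · exact (hDb q hq).trans hbc
      · exact hq.2
  · rintro a (ha | ha)
    · exact (hx.intervalIntegrable b hb a ha).congr ((hl a ha).mono uIoc_subset_uIcc)
    · exact (hy.intervalIntegrable b hb' a ha).congr ((hr a ha).mono uIoc_subset_uIcc)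
  · rintro a (ha | ha)
    · rw [hzx a (hDb a ha), hzx b le_rfl, hx.integral_eq b hb a ha,
        intervalIntegral.integral_congr (hl a ha)]
    · rw [hzy a ha.1, hzy b le_rfl, hy.integral_eq b hb' a ha,
        intervalIntegral.integral_congr (hr a ha)]

theorem CondC1.exists_bound {γ : ℝ → ℝ} (hC1 : CondC1 f γ) (hγ : ClassK γ) {R C : ℝ}
    (hR : 0 ≤ R) (hC : 0 ≤ C) :
    ∃ M, 0 ≤ M ∧ ∀ t, 0 ≤ t → ∀ (ξ : E) (μ : F) (i : Γ), ‖ξ‖ ≤ R → ‖μ‖ ≤ C →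
      ‖f t ξ μ i‖ ≤ M := by
  obtain ⟨N, hN, hNm, hb⟩ := hC1
  have hγ0 : ∀ s, 0 ≤ s → 0 ≤ γ s := fun s hs => by
    have := hγ.2.1.monotoneOn (mem_Ici.2 le_rfl) (mem_Ici.2 hs) hs
    rwa [hγ.2.2] at this
  refine ⟨N R * (1 + γ C), mul_nonneg (hN R hR).le (by linarith [hγ0 C hC]), ?_⟩
  intro t ht ξ μ i hξ hμ
  refine (hb t ht ξ μ i).trans ?_
  have h1 := hNm (mem_Ici.2 (norm_nonneg ξ)) (mem_Ici.2 hR) hξ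
  have h2 := hγ.2.1.monotoneOn (mem_Ici.2 (norm_nonneg μ)) (mem_Ici.2 hC) hμ
  have h3 := hγ0 _ (norm_nonneg μ)
  exact mul_le_mul h1 (by linarith) (by linarith) (hN R hR).le

variable [BorelSpace E] [ProperSpace E] [BorelSpace F] [SecondCountableTopology F]

theorem exists_local_solution {γ : ℝ → ℝ} (hreg : Regular f) (hγ : ClassK γ)
    (hC1 : CondC1 f γ) (hσ : IsSwitchingSignal σ) (hu : IsInput u) {b : ℝ} (hb : 0 ≤ b)
    (ξ₀ : E) : ∃ c, b < c ∧ ∃ y : ℝ → E, y b = ξ₀ ∧ IsSolution f u σ (Icc b c) y := by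
  classical
  obtain ⟨C, hC⟩ := hu.2 (b + 1)
  set R := ‖ξ₀‖ + 1 with hR
  have hR0 : 0 < R := by positivity
  obtain ⟨M, hM0, hM⟩ := hC1.exists_bound hγ hR0.le (le_max_right C 0)
  let pr : E → E := fun ξ => (R / max R ‖ξ‖) • ξ
  have hmax : ∀ ξ : E, 0 < max R ‖ξ‖ := fun ξ => lt_max_of_lt_left hR0
  have hprc : Continuous pr :=
    (continuous_const.div (by fun_prop) fun ξ => (hmax ξ).ne').smul continuous_id
  have hprn : ∀ ξ, ‖pr ξ‖ ≤ R := by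
    intro ξ
    rw [norm_smul, Real.norm_eq_abs, abs_of_nonneg (div_nonneg hR0.le (hmax ξ).le), div_mul_eq_mul_div,
      div_le_iff₀ (hmax ξ)]
    exact mul_le_mul_of_nonneg_left (le_max_right _ _) hR0.le
  have hpre : ∀ ξ, ‖ξ‖ ≤ R → pr ξ = ξ := by
    intro ξ hξ
    simp only [pr, max_eq_left hξ, div_self hR0.ne', one_smul]
  let G : ℝ → E → E := fun t ξ =>
    if 0 ≤ t ∧ ‖u t‖ ≤ max C 0 then f t (pr ξ) (u t) (σ (max 0 t)) else 0
  have hGm : ∀ ξ, Measurable fun t => G t ξ := by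
    intro ξ
    refine Measurable.ite ((measurableSet_le measurable_const measurable_id).inter
      (measurableSet_le hu.1.norm measurable_const)) ?_ measurable_const
    exact (hσ.measurable_uncurry hreg.2.1 hreg.2.2).comp
      ((measurable_const.prodMk hu.1).prodMk measurable_id)
  have hGc : ∀ t, Continuous (G t) := by
    intro t
    by_cases ht : 0 ≤ t ∧ ‖u t‖ ≤ max C 0
    · simp only [G, if_pos ht]
      exact (hreg.2.2 t _).comp (hprc.prodMk continuous_const)
    · simp only [G, if_neg ht]
      exact continuous_const
  have hGM : ∀ t ξ, ‖G t ξ‖ ≤ M := by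
    intro t ξ
    by_cases ht : 0 ≤ t ∧ ‖u t‖ ≤ max C 0
    · simp only [G, if_pos ht]
      exact hM t ht.1 _ _ _ (hprn ξ) ht.2
    · simpa only [G, if_neg ht, norm_zero] using hM0
  obtain ⟨y, -, hyint, hye⟩ := exists_integral_solution hGm hGc hGM (by linarith : b ≤ b + 1) ξ₀
  have hM1 : 0 < 1 / (M + 1) := by positivity
  have hM2 : 1 / (M + 1) ≤ 1 := by
    rw [div_le_one (by positivity)]
    linarith
  have hsub : ∀ a ∈ Icc b (b + 1 / (M + 1)), uIcc b a ⊆ Icc b (b + 1 / (M + 1)) := by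
    intro a ha
    rw [uIcc_of_le ha.1]
    exact Icc_subset_Icc_right ha.2
  have hyR : ∀ t ∈ Icc b (b + 1 / (M + 1)), ‖y t‖ ≤ R := by
    intro t ht
    have h1 : ‖∫ s in b..t, G s (y s)‖ ≤ M * |t - b| :=
      intervalIntegral.norm_integral_le_of_norm_le_const fun s _ => hGM _ _
    rw [hye t ⟨ht.1, by linarith [ht.2]⟩]
    refine (norm_add_le _ _).trans ?_
    rw [hR]
    refine add_le_add le_rfl (h1.trans ?_)
    rw [abs_of_nonneg (by linarith [ht.1])]
    have h2 : t - b ≤ 1 / (M + 1) := by linarith [ht.2]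
    calc M * (t - b) ≤ M * (1 / (M + 1)) := by gcongr
      _ ≤ 1 := by
        rw [mul_one_div, div_le_one (by positivity)]
        linarith
  have hae : ∀ᵐ s ∂volume, s ∈ Icc b (b + 1 / (M + 1)) →
      G s (y s) = f s (y s) (u s) (σ s) := by
    filter_upwards [hC] with s hs hsI
    have hs0 : 0 ≤ s := hb.trans hsI.1
    have hcond : 0 ≤ s ∧ ‖u s‖ ≤ max C 0 :=
      ⟨hs0, (hs ⟨hs0, by linarith [hsI.2]⟩).trans (le_max_left _ _)⟩
    simp only [G, if_pos hcond, hpre _ (hyR s hsI), max_eq_right hs0]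
  have hyb : y b = ξ₀ := by
    rw [hye b ⟨le_rfl, by linarith⟩]
    simp
  refine ⟨b + 1 / (M + 1), by linarith, y, hyb, IsSolution.of_base (t₀ := b) ordConnected_Icc
    (fun s hs => hb.trans hs.1) ⟨le_rfl, by linarith⟩ (fun a ha => ?_) fun a ha => ?_⟩
  · refine (hyint.mono_set ?_).congr_ae ?_
    · rw [uIcc_of_le ha.1, uIcc_of_le (by linarith)]
      exact Icc_subset_Icc_right (by linarith [ha.2])
    · rw [Filter.EventuallyEq, ae_restrict_iff' measurableSet_uIoc]
      filter_upwards [hae] with s hs hsI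
      exact hs (hsub a ha (uIoc_subset_uIcc hsI))
  · rw [hye a ⟨ha.1, by linarith [ha.2]⟩, hyb]
    congr 1
    refine intervalIntegral.integral_congr_ae ?_
    filter_upwards [hae] with s hs hsI
    exact hs (hsub a ha (uIoc_subset_uIcc hsI))

theorem IsSolution.exists_insert_right {γ : ℝ → ℝ} (hreg : Regular f) (hγ : ClassK γ)
    (hC1 : CondC1 f γ) (hσ : IsSwitchingSignal σ) (hu : IsInput u)
    (hx : IsSolution f u σ D x) {t₀ b R : ℝ} (ht₀ : t₀ ∈ D) (ht₀b : t₀ < b)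
    (hDb : ∀ s ∈ D, s < b) (hsub : Ico t₀ b ⊆ D) (hR : ∀ s ∈ Ico t₀ b, ‖x s‖ ≤ R) :
    ∃ y, IsSolution f u σ (insert b D) y ∧ EqOn x y D := by
  have ht₀0 : 0 ≤ t₀ := hx.subset_Ici ht₀
  have hR0 : 0 ≤ R := (norm_nonneg _).trans (hR t₀ ⟨le_rfl, ht₀b⟩)
  obtain ⟨C, hC⟩ := hu.2 b
  obtain ⟨M, -, hM⟩ := hC1.exists_bound hγ hR0 (le_max_right C 0)
  have hint : IntervalIntegrable (fun s => f s (x s) (u s) (σ s)) volume t₀ b := by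
    rw [intervalIntegrable_iff_integrableOn_Ico_of_le ht₀b.le]
    have hfin : IsFiniteMeasure (volume.restrict (Ico t₀ b)) := ⟨by simp⟩
    refine Integrable.of_bound (hσ.aemeasurable_comp hreg.2.1 hreg.2.2 measurableSet_Ico
      (fun s hs => ht₀0.trans hs.1) ((hx.continuousOn.mono hsub).aemeasurable measurableSet_Ico)
      hu.1).aestronglyMeasurable M ((ae_restrict_iff' measurableSet_Ico).2 ?_)
    filter_upwards [hC] with s hs hsI
    have hs0 : 0 ≤ s := ht₀0.trans hsI.1
    exact hM s hs0 _ _ _ (hR s hsI) ((hs ⟨hs0, hsI.2.le⟩).trans (le_max_left _ _))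
  let y := Function.update x b (x t₀ + ∫ s in t₀..b, f s (x s) (u s) (σ s))
  have hyx : ∀ s, s ≠ b → y s = x s := fun s hs => Function.update_of_ne hs _ _
  have hae : ∀ᵐ s ∂volume, f s (x s) (u s) (σ s) = f s (y s) (u s) (σ s) := by
    filter_upwards [compl_mem_ae_iff.2 (measure_singleton b)] with s hs
    rw [hyx s hs]
  have hint' : ∀ a ∈ insert b D, IntervalIntegrable (fun s => f s (x s) (u s) (σ s))
      volume t₀ a := by
    rintro a (rfl | ha)
    · exact hint
    · exact hx.intervalIntegrable t₀ ht₀ a ha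
  refine ⟨y, IsSolution.of_base (t₀ := t₀) ⟨?_⟩
    (insert_subset (ht₀0.trans ht₀b.le) hx.subset_Ici) (mem_insert_of_mem b ht₀)
    (fun a ha => (hint' a ha).congr_ae (ae_restrict_of_ae hae)) fun a ha => ?_,
    fun s hs => (hyx s (hDb s hs).ne).symm⟩
  · intro p hp q hq s hs
    have hqb : q ≤ b := by
      rcases hq with rfl | hq
      · exact le_rfl
      · exact (hDb q hq).le
    rcases (hs.2.trans hqb).eq_or_lt with rfl | hsb
    · exact mem_insert _ _
    refine mem_insert_of_mem b ?_
    have hpD : p ∈ D := by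
      rcases hp with rfl | hp
      · exact absurd hs.1 (not_le.2 hsb)
      · exact hp
    rcases le_total t₀ s with h | h
    · exact hsub ⟨h, hsb⟩
    · exact hx.ordConnected.out hpD ht₀ ⟨hs.1, h⟩
  · rw [hyx t₀ ht₀b.ne, ← intervalIntegral.integral_congr_ae (hae.mono fun s hs _ => hs)]
    rcases ha with rfl | ha
    · exact Function.update_self _ _ _
    · rw [hyx a (hDb a ha).ne]
      exact hx.integral_eq t₀ ht₀ a ha

/-- A maximal solution that is bounded on bounded time intervals is defined for all future
times. -/
theorem IsMaximalSolution.Ici_subset {γ : ℝ → ℝ} (hreg : Regular f) (hγ : ClassK γ)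
    (hC1 : CondC1 f γ) (hσ : IsSwitchingSignal σ) (hu : IsInput u)
    (hx : IsMaximalSolution f u σ D x) {t₀ : ℝ} (ht₀ : t₀ ∈ D)
    (hbd : ∀ T, ∃ R, ∀ t ∈ D, t₀ ≤ t → t ≤ T → ‖x t‖ ≤ R) : Ici t₀ ⊆ D := by
  obtain ⟨hsol, hmax⟩ := hx
  by_contra hcon
  obtain ⟨t₁, ht₁, ht₁D⟩ := not_subset.1 hcon
  have hDt₁ : ∀ s ∈ D, s < t₁ := fun s hs => by
    by_contra hlt
    exact ht₁D (hsol.ordConnected.out ht₀ hs ⟨ht₁, not_lt.1 hlt⟩)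
  have hbdd : BddAbove D := ⟨t₁, fun s hs => (hDt₁ s hs).le⟩
  have hle : ∀ s ∈ D, s ≤ sSup D := fun s hs => le_csSup hbdd hs
  by_cases hb : sSup D ∈ D
  · obtain ⟨c, hc, y, hyb, hy⟩ :=
      exists_local_solution hreg hγ hC1 hσ hu (hsol.subset_Ici hb) (x (sSup D))
    have hcD := hmax _ _ (hsol.glue_right hb hle hc.le hy hyb) subset_union_left
      (fun s hs => (if_pos (hle s hs)).symm) (Or.inr ⟨hc.le, le_rfl⟩)
    exact absurd (hle c hcD) (not_le.2 hc)
  · have hlt : ∀ s ∈ D, s < sSup D := fun s hs =>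
      (hle s hs).lt_of_ne fun h => hb (h ▸ hs)
    have hsub : Ico t₀ (sSup D) ⊆ D := by
      intro s hs
      obtain ⟨q, hq, hsq⟩ := exists_lt_of_lt_csSup ⟨t₀, ht₀⟩ hs.2
      exact hsol.ordConnected.out ht₀ hq ⟨hs.1, hsq.le⟩
    obtain ⟨R, hR⟩ := hbd (sSup D)
    obtain ⟨y, hy, hxy⟩ := hsol.exists_insert_right hreg hγ hC1 hσ hu ht₀ (hlt t₀ ht₀) hlt hsub
      fun s hs => hR s (hsub hs) hs.1 hs.2.le
    exact hb (hmax _ y hy (subset_insert _ _) hxy (mem_insert _ _))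

end Solutions

section ComparisonFunctions

variable {φ ψ : ℝ → ℝ}

theorem ClassK.mono (h : ClassK φ) {a b : ℝ} (ha : 0 ≤ a) (hab : a ≤ b) : φ a ≤ φ b :=
  h.2.1.monotoneOn (mem_Ici.2 ha) (mem_Ici.2 (ha.trans hab)) hab

theorem ClassK.nonneg (h : ClassK φ) {a : ℝ} (ha : 0 ≤ a) : 0 ≤ φ a := by
  simpa [h.2.2] using h.mono le_rfl ha

theorem ClassK.pos (h : ClassK φ) {a : ℝ} (ha : 0 < a) : 0 < φ a := by
  simpa [h.2.2] using h.2.1 (mem_Ici.2 le_rfl) (mem_Ici.2 ha.le) ha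

theorem ClassK.le_of_le (h : ClassK φ) {a b : ℝ} (ha : 0 ≤ a) (hb : 0 ≤ b)
    (hab : φ a ≤ φ b) : a ≤ b :=
  (h.2.1.le_iff_le (mem_Ici.2 ha) (mem_Ici.2 hb)).1 hab

theorem ClassK.tendsto_zero (h : ClassK φ) : Tendsto φ (𝓝[≥] 0) (𝓝 0) := by
  simpa [ContinuousWithinAt, h.2.2] using h.1 0 (mem_Ici.2 le_rfl)

theorem ClassK.exists_lt (h : ClassK φ) {ε : ℝ} (hε : 0 < ε) : ∃ δ, 0 < δ ∧ φ δ < ε := by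
  have h1 : ∀ᶠ s in 𝓝[>] (0 : ℝ), φ s < ε :=
    (h.tendsto_zero.mono_left (nhdsWithin_mono _ Ioi_subset_Ici_self)).eventually_lt_const hε
  obtain ⟨δ, hδ, hδ0⟩ := (h1.and self_mem_nhdsWithin).exists
  exact ⟨δ, hδ0, hδ⟩

theorem ClassKInf.exists_ge (h : ClassKInf φ) (c : ℝ) : ∃ R, 0 < R ∧ c ≤ φ R :=
  let ⟨R, hR⟩ := ((eventually_gt_atTop 0).and (h.2.eventually_ge_atTop c)).exists
  ⟨R, hR⟩

theorem ClassKInf.comp (hφ : ClassKInf φ) (hψ : ClassKInf ψ) :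
    ClassKInf fun s => φ (ψ s) := by
  have hmaps : MapsTo ψ (Ici 0) (Ici 0) := fun s hs => hψ.1.nonneg hs
  exact ⟨⟨hφ.1.1.comp hψ.1.1 hmaps, hφ.1.2.1.comp hψ.1.2.1 hmaps, by
    simp [hψ.1.2.2, hφ.1.2.2]⟩, hφ.2.comp hψ.2⟩

theorem ClassKInf.add_id (hφ : ClassKInf φ) : ClassKInf fun s => φ s + s :=
  ⟨⟨hφ.1.1.add continuousOn_id, hφ.1.2.1.add (strictMono_id.strictMonoOn _), by
    simp [hφ.1.2.2]⟩, hφ.2.atTop_add_atTop tendsto_id⟩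

theorem classKInf_two_mul : ClassKInf fun s : ℝ => 2 * s :=
  ⟨⟨by fun_prop, fun a _ b _ hab => by simpa using hab, by simp⟩,
    tendsto_id.const_mul_atTop two_pos⟩

theorem ClassKInf.exists_inverse (h : ClassKInf φ) :
    ∃ ψ, ClassKInf ψ ∧ (∀ s, 0 ≤ s → ψ (φ s) = s) := by
  classical
  let g : ℝ → ℝ := fun s => if 0 ≤ s then φ s else s
  have hgp : ∀ s, 0 ≤ s → g s = φ s := fun s hs => if_pos hs
  have hgn : ∀ s, s < 0 → g s = s := fun s hs => if_neg (not_le.2 hs)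
  have hmono : StrictMono g := by
    intro a b hab
    rcases lt_or_ge a 0 with ha | ha
    · rw [hgn a ha]
      rcases lt_or_ge b 0 with hb | hb
      · rwa [hgn b hb]
      · rw [hgp b hb]
        exact ha.trans_le (h.1.nonneg hb)
    · rw [hgp a ha, hgp b (ha.trans hab.le)]
      exact h.1.2.1 (mem_Ici.2 ha) (mem_Ici.2 (ha.trans hab.le)) hab
  have hsurj : Function.Surjective g := by
    intro c
    rcases lt_or_ge c 0 with hc | hc
    · exact ⟨c, hgn c hc⟩
    · obtain ⟨R, hR, hcR⟩ := h.exists_ge c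
      obtain ⟨s, hs, hsc⟩ := intermediate_value_Icc hR.le (h.1.1.mono Icc_subset_Ici_self)
        (show c ∈ Icc (φ 0) (φ R) from ⟨by rwa [h.1.2.2], hcR⟩)
      exact ⟨s, (hgp s hs.1).trans hsc⟩
  let e := hmono.orderIsoOfSurjective g hsurj
  have he : ∀ s, e.symm (g s) = s := fun s => e.symm_apply_apply s
  refine ⟨e.symm, ⟨⟨e.symm.continuous.continuousOn, e.symm.strictMono.strictMonoOn _, ?_⟩,
    e.symm.tendsto_atTop⟩, fun s hs => ?_⟩
  · have := he 0
    rwa [hgp 0 le_rfl, h.1.2.2] at this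
  · rw [← hgp s hs, he]

/-- A family of sets that increases with the first parameter, decreases with the second, is
bounded by a class-`K` function and becomes uniformly small is bounded by a class-`KL` function. -/
theorem exists_classKL_bound {B : ℝ → ℝ → Set ℝ}
    (hB : ∀ r r' s s', r ≤ r' → s' ≤ s → B r s ⊆ B r' s') (hφ : ClassK φ)
    (hle : ∀ r, 0 ≤ r → ∀ s, ∀ w ∈ B r s, w ≤ φ r)
    (hlim : ∀ r, 0 < r → ∀ ε, 0 < ε → ∃ T, ∀ w ∈ B r T, w ≤ ε) :
    ∃ b, ClassKL b ∧ ∀ r, 0 ≤ r → ∀ s, ∀ w ∈ B r s, w ≤ b r s := by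
  let g : ℝ → ℝ → ℝ := fun r s => sSup (insert 0 (B r s))
  have hmem : ∀ r, ∀ s, ∀ w ∈ insert 0 (B r s), w ≤ φ (max r 0) := by
    rintro r s w (rfl | hw)
    · exact hφ.nonneg (le_max_right _ _)
    · exact hle _ (le_max_right _ _) s w (hB _ _ _ _ (le_max_left _ _) le_rfl hw)
  have hbdd : ∀ r s, BddAbove (insert 0 (B r s)) := fun r s => ⟨_, hmem r s⟩
  have hg0 : ∀ r s, 0 ≤ g r s := fun r s => le_csSup (hbdd r s) (mem_insert _ _)
  have hgφ : ∀ r s, g r s ≤ φ (max r 0) := fun r s => csSup_le (insert_nonempty _ _) (hmem r s)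
  have hgw : ∀ r s, ∀ w ∈ B r s, w ≤ g r s := fun r s w hw =>
    le_csSup (hbdd r s) (mem_insert_of_mem _ hw)
  have hgm : ∀ r r' s s', r ≤ r' → s' ≤ s → g r s ≤ g r' s' := fun r r' s s' hr hs =>
    csSup_le_csSup (hbdd r' s') (insert_nonempty _ _) (insert_subset_insert (hB _ _ _ _ hr hs))
  have hgs : ∀ s, Monotone fun r => g r s := fun s r r' hr => hgm r r' s s hr le_rfl
  have hgz : ∀ s, g 0 s = 0 := fun s =>
    le_antisymm (by simpa [hφ.2.2] using hgφ 0 s) (hg0 0 s)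
  have hint : ∀ r, 0 ≤ r → ∀ s, IntervalIntegrable (fun v => g (r * v) s) volume 1 2 :=
    fun r hr s => ((hgs s).comp fun v v' hv => mul_le_mul_of_nonneg_left hv hr).intervalIntegrable
  let I : ℝ → ℝ → ℝ := fun r s => ∫ v in (1 : ℝ)..2, g (r * v) s
  have hI : ∀ r r' s s', 0 ≤ r → r ≤ r' → s' ≤ s → I r s ≤ I r' s' := by
    intro r r' s s' h0 hr hs
    refine intervalIntegral.integral_mono_on one_le_two (hint r h0 s) (hint r' (h0.trans hr) s')
      fun v hv => hgm _ _ _ _ (mul_le_mul_of_nonneg_right hr (by linarith [hv.1])) hs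
  have hIl : ∀ r, 0 ≤ r → ∀ s, g r s ≤ I r s := by
    intro r hr s
    have : ∫ v in (1 : ℝ)..2, g r s ≤ I r s :=
      intervalIntegral.integral_mono_on one_le_two (by simp) (hint r hr s)
        fun v hv => hgs s (by nlinarith [hv.1])
    rw [intervalIntegral.integral_const, smul_eq_mul] at this
    linarith
  have hIu : ∀ r, 0 ≤ r → ∀ s, I r s ≤ g (r * 2) s := by
    intro r hr s
    have : I r s ≤ ∫ v in (1 : ℝ)..2, g (r * 2) s :=
      intervalIntegral.integral_mono_on one_le_two (hint r hr s) (by simp)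
        fun v hv => hgs s (by nlinarith [hv.2])
    rw [intervalIntegral.integral_const, smul_eq_mul] at this
    linarith
  have hI0 : ∀ r, 0 ≤ r → ∀ s, 0 ≤ I r s := fun r hr s => (hg0 r s).trans (hIl r hr s)
  have hIz : ∀ s, I 0 s = 0 := fun s => by simp [I, hgz]
  have hIc : ∀ s, ContinuousOn (fun r => I r s) (Ici 0) := by
    intro s r hr
    rcases (mem_Ici.1 hr).eq_or_lt with rfl | hr
    · rw [ContinuousWithinAt, hIz]
      have h2 : Tendsto (fun r : ℝ => r * 2) (𝓝[≥] 0) (𝓝[≥] 0) := by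
        refine tendsto_nhdsWithin_iff.2 ⟨?_, ?_⟩
        · exact (Continuous.tendsto' (by fun_prop) 0 0 (by simp)).mono_left nhdsWithin_le_nhds
        · filter_upwards [self_mem_nhdsWithin] with r hr
          exact mem_Ici.2 (mul_nonneg hr zero_le_two)
      refine tendsto_of_tendsto_of_tendsto_of_le_of_le' tendsto_const_nhds
        (hφ.tendsto_zero.comp h2) ?_ ?_
      · filter_upwards [self_mem_nhdsWithin] with r hr using hI0 r hr s
      · filter_upwards [self_mem_nhdsWithin] with r hr
        have hr' : (0 : ℝ) ≤ r * 2 := mul_nonneg hr zero_le_two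
        have := (hIu r hr s).trans (hgφ (r * 2) s)
        rwa [max_eq_left hr'] at this
    · refine ContinuousAt.continuousWithinAt ?_
      have hp : Continuous fun r => ∫ v in (0 : ℝ)..r, g v s :=
        intervalIntegral.continuous_primitive (fun a b => (hgs s).intervalIntegrable) 0
      have hc : ContinuousAt
          (fun r : ℝ => r⁻¹ * ((∫ v in (0 : ℝ)..r * 2, g v s) - ∫ v in (0 : ℝ)..r, g v s)) r :=
        (continuousAt_inv₀ hr.ne').mul
          ((hp.comp (continuous_id.mul continuous_const)).sub hp).continuousAt
      refine hc.congr ?_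
      filter_upwards [lt_mem_nhds hr] with q hq
      rw [intervalIntegral.integral_interval_sub_left (hgs s).intervalIntegrable
        (hgs s).intervalIntegrable]
      simp only [I]
      rw [intervalIntegral.integral_comp_mul_left (fun v => g v s) hq.ne', mul_one, smul_eq_mul]
  refine ⟨fun r s => I r s + r * Real.exp (-s), ⟨fun s _ => ⟨⟨?_, ?_, ?_⟩, ?_⟩,
    fun r hr => ⟨?_, ?_⟩⟩, fun r hr s w hw => ?_⟩
  · exact (hIc s).add (by fun_prop)
  · intro a ha b hb hab
    exact add_lt_add_of_le_of_lt (hI a b s s ha hab.le le_rfl)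
      (mul_lt_mul_of_pos_right hab (Real.exp_pos _))
  · simp [hIz]
  · refine tendsto_atTop_mono' _ ?_ (tendsto_id.atTop_mul_const (Real.exp_pos (-s)))
    filter_upwards [eventually_ge_atTop 0] with r hr
    simpa using hI0 r hr s
  · intro s _ s' _ hs
    exact add_le_add (hI r r _ _ hr le_rfl hs)
      (mul_le_mul_of_nonneg_left (Real.exp_le_exp.2 (by linarith)) hr)
  · have h1 : Tendsto (fun s => r * Real.exp (-s)) atTop (𝓝 0) := by
      simpa using (Real.tendsto_exp_neg_atTop_nhds_zero).const_mul r
    have h2 : Tendsto (fun s => I r s) atTop (𝓝 0) := by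
      rcases hr.eq_or_lt with rfl | hr
      · simp [hIz]
      refine Metric.tendsto_atTop.2 fun ε hε => ?_
      obtain ⟨T, hT⟩ := hlim (r * 2) (by positivity) (ε / 2) (by positivity)
      refine ⟨T, fun s hs => ?_⟩
      rw [Real.dist_eq, sub_zero, abs_of_nonneg (hI0 r hr.le s)]
      have h3 : g (r * 2) T ≤ ε / 2 := by
        refine csSup_le (insert_nonempty _ _) ?_
        rintro w (rfl | hw)
        · positivity
        · exact hT w hw
      have h4 := hgm (r * 2) (r * 2) s T le_rfl hs
      linarith [hIu r hr.le s]
    simpa using h2.add h1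
  · have := hgw r s w hw
    have h1 := hIl r hr s
    have h2 : 0 ≤ r * Real.exp (-s) := mul_nonneg hr (Real.exp_pos _).le
    linarith

end ComparisonFunctions

section Perturbation

theorem le_mul_exp_of_le_add_integral {w : ℝ → ℝ} {a b A L : ℝ} (hab : a ≤ b) (hL : 0 ≤ L)
    (hw : ContinuousOn w (Icc a b)) (h : ∀ t ∈ Icc a b, w t ≤ A + L * ∫ s in a..t, w s) :
    ∀ t ∈ Icc a b, w t ≤ A * Real.exp (L * (t - a)) := by
  let w' : ℝ → ℝ := IccExtend hab ((Icc a b).domRestrict w)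
  have hw' : Continuous w' := (continuousOn_iff_continuous_domRestrict.1 hw).Icc_extend'
  have heq : ∀ t ∈ Icc a b, w' t = w t := fun t ht => IccExtend_of_mem hab _ ht
  have hint : ∀ t ∈ Icc a b, ∫ s in a..t, w' s = ∫ s in a..t, w s := by
    intro t ht
    refine intervalIntegral.integral_congr fun s hs => ?_
    rw [uIcc_of_le ht.1] at hs
    exact heq s ⟨hs.1, hs.2.trans ht.2⟩
  have hderiv : ∀ t, HasDerivAt (fun t => A + L * ∫ s in a..t, w' s) (L * w' t) t := fun t =>
    ((intervalIntegral.integral_hasDerivAt_right (hw'.intervalIntegrable _ _)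
      (hw'.stronglyMeasurableAtFilter _ _) hw'.continuousAt).const_mul L).const_add A
  intro t ht
  have hle : ∀ s ∈ Icc a b, w' s ≤ A + L * ∫ r in a..s, w' r := fun s hs => by
    rw [heq s hs, hint s hs]
    exact h s hs
  have := le_gronwallBound_of_liminf_deriv_right_le (δ := A) (K := L) (ε := 0)
    (fun s _ => (hderiv s).continuousAt.continuousWithinAt)
    (fun s _ r hr => ((hderiv s).hasDerivWithinAt (s := Ici s)).liminf_right_slope_le hr)
    (by simp) (fun s hs => by
      rw [add_zero]
      exact mul_le_mul_of_nonneg_left (hle s ⟨hs.1, hs.2.le⟩) hL) t ht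
  rw [gronwallBound_ε0] at this
  rw [← heq t ht]
  exact (hle t ht).trans this

variable [BorelSpace E] [ProperSpace E] [BorelSpace F] [SecondCountableTopology F]
  {f : ℝ → E → F → Γ → E} {γ : ℝ → ℝ}

/-- On bounded sets the effect of the input is controlled by a small constant plus a multiple
of its `γ`-energy density. -/
theorem AssumptionA.exists_input_bound (hA : AssumptionA f γ) {R ε : ℝ} (hR : 0 < R)
    (hε : 0 < ε) :
    ∃ κ, 0 < κ ∧ ∀ t, 0 ≤ t → ∀ (ξ : E) (μ : F) (i : Γ), ‖ξ‖ ≤ R →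
      ‖f t ξ μ i - f t ξ 0 i‖ ≤ ε + κ * γ ‖μ‖ := by
  obtain ⟨hγ, ⟨N, hN, hNm, hNb⟩, hC2, -⟩ := hA
  obtain ⟨δ, hδ, hδb⟩ := hC2 R hR ε hε
  have hγδ := hγ.pos hδ
  have hNR := hN R hR.le
  refine ⟨N R * (2 / γ δ + 1), by positivity, fun t ht ξ μ i hξ => ?_⟩
  have hγμ := hγ.nonneg (norm_nonneg μ)
  rcases le_total ‖μ‖ δ with hμ | hμ
  · have : 0 ≤ N R * (2 / γ δ + 1) * γ ‖μ‖ := by positivity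
    linarith [hδb t ht i ξ μ hξ hμ]
  · have h1 := hNb t ht ξ μ i
    have h2 := hNb t ht ξ 0 i
    rw [norm_zero, hγ.2.2, add_zero, mul_one] at h2
    have h3 := hNm (mem_Ici.2 (norm_nonneg ξ)) (mem_Ici.2 hR.le) hξ
    have h4 : N ‖ξ‖ * (1 + γ ‖μ‖) ≤ N R * (1 + γ ‖μ‖) :=
      mul_le_mul_of_nonneg_right h3 (by linarith)
    have h5 : 2 ≤ 2 / γ δ * γ ‖μ‖ := by
      rw [div_mul_eq_mul_div, le_div_iff₀ hγδ]
      linarith [hγ.mono hδ.le hμ]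
    have h6 : N R * 2 ≤ N R * (2 / γ δ * γ ‖μ‖) := mul_le_mul_of_nonneg_left h5 hNR.le
    have h7 := norm_sub_le (f t ξ μ i) (f t ξ 0 i)
    have h8 : N R * (2 / γ δ + 1) * γ ‖μ‖ = N R * (2 / γ δ * γ ‖μ‖) + N R * γ ‖μ‖ := by ring
    linarith

/-- Over a fixed time horizon, a solution generated by an input of small `γ`-energy stays close
to the zero-input solution with the same initial value. -/
theorem AssumptionA.exists_energy_bound (hA : AssumptionA f γ) {R τ δ : ℝ}
    (hR : 0 < R) (hτ : 0 < τ) (hδ : 0 < δ) :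
    ∃ e, 0 < e ∧ ∀ (t₀ : ℝ) (u : ℝ → F) (σ : ℝ → Γ) (D D' : Set ℝ) (x y : ℝ → E),
      IsInput u → IsSolution f u σ D x →
      IsSolution f (fun _ => (0 : F)) σ D' y → Icc t₀ (t₀ + τ) ⊆ D → Icc t₀ (t₀ + τ) ⊆ D' →
      x t₀ = y t₀ → (∀ s ∈ Icc t₀ (t₀ + τ), ‖x s‖ ≤ R) → (∀ s ∈ Icc t₀ (t₀ + τ), ‖y s‖ ≤ R) →
      (∫ s in t₀..(t₀ + τ), γ ‖u s‖) ≤ e → ‖x (t₀ + τ) - y (t₀ + τ)‖ ≤ δ := by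
  have hγ := hA.1
  obtain ⟨L, hL0, hL⟩ := hA.2.2.2 (Metric.closedBall 0 R) (isCompact_closedBall _ _)
  have hexp := Real.exp_pos (L * τ)
  obtain ⟨κ, hκ0, hκ⟩ := hA.exists_input_bound hR
    (show 0 < δ / (2 * τ * Real.exp (L * τ)) by positivity)
  refine ⟨δ / (2 * κ * Real.exp (L * τ)), by positivity, ?_⟩
  intro t₀ u σ D D' x y hu hx hy hD hD' hxy hxR hyR hen
  set ε := δ / (2 * τ * Real.exp (L * τ)) with hε
  have hε0 : 0 < ε := by positivity
  have hle : t₀ ≤ t₀ + τ := by linarith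
  have ht₀ : t₀ ∈ Icc t₀ (t₀ + τ) := left_mem_Icc.2 hle
  have ht₀0 : 0 ≤ t₀ := hx.subset_Ici (hD ht₀)
  have hcw : ContinuousOn (fun s => ‖x s - y s‖) (Icc t₀ (t₀ + τ)) :=
    ((hx.continuousOn.mono hD).sub (hy.continuousOn.mono hD')).norm
  have hγint := hu.intervalIntegrable hγ.1 ht₀0 hle
  have hγpos : ∀ s, 0 ≤ γ ‖u s‖ := fun s => hγ.nonneg (norm_nonneg _)
  have key : ∀ t ∈ Icc t₀ (t₀ + τ), ‖x t - y t‖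
      ≤ (ε * τ + κ * (δ / (2 * κ * Real.exp (L * τ)))) + L * ∫ s in t₀..t, ‖x s - y s‖ := by
    intro t ht
    have hsub : Icc t₀ t ⊆ Icc t₀ (t₀ + τ) := Icc_subset_Icc_right ht.2
    have hfx := hx.intervalIntegrable t₀ (hD ht₀) t (hD ht)
    have hfy := hy.intervalIntegrable t₀ (hD' ht₀) t (hD' ht)
    have hγt : IntervalIntegrable (fun s => γ ‖u s‖) volume t₀ t :=
      hu.intervalIntegrable hγ.1 ht₀0 ht.1
    have hwt : IntervalIntegrable (fun s => ‖x s - y s‖) volume t₀ t := by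
      refine ContinuousOn.intervalIntegrable ?_
      rw [uIcc_of_le ht.1]
      exact hcw.mono hsub
    have h1 : x t - y t
        = ∫ s in t₀..t, (f s (x s) (u s) (σ s) - f s (y s) 0 (σ s)) := by
      rw [intervalIntegral.integral_sub hfx hfy, hx.integral_eq t₀ (hD ht₀) t (hD ht),
        hy.integral_eq t₀ (hD' ht₀) t (hD' ht), hxy]
      abel
    have hc : IntervalIntegrable (fun _ : ℝ => ε) volume t₀ t := by simp
    have h2 : ‖x t - y t‖ ≤ ∫ s in t₀..t, ((ε + κ * γ ‖u s‖) + L * ‖x s - y s‖) := by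
      rw [h1]
      refine intervalIntegral.norm_integral_le_of_norm_le ht.1 (ae_of_all _ fun s hs => ?_)
        ((hc.add (hγt.const_mul κ)).add (hwt.const_mul L))
      have hs' : s ∈ Icc t₀ (t₀ + τ) := hsub ⟨hs.1.le, hs.2⟩
      have hs0 : 0 ≤ s := ht₀0.trans hs'.1
      have ha := hκ s hs0 (x s) (u s) (σ s) (hxR s hs')
      have hb := hL s hs0 (σ s) (x s) (by simpa using hxR s hs') (y s) (by simpa using hyR s hs')
      have : f s (x s) (u s) (σ s) - f s (y s) 0 (σ s)
          = (f s (x s) (u s) (σ s) - f s (x s) 0 (σ s))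
            + (f s (x s) 0 (σ s) - f s (y s) 0 (σ s)) := by abel
      rw [this]
      exact (norm_add_le _ _).trans (add_le_add ha hb)
    rw [intervalIntegral.integral_add (hc.add (hγt.const_mul κ)) (hwt.const_mul L),
      intervalIntegral.integral_add hc (hγt.const_mul κ), intervalIntegral.integral_const,
      intervalIntegral.integral_const_mul, intervalIntegral.integral_const_mul, smul_eq_mul] at h2
    have h3 : ∫ s in t₀..t, γ ‖u s‖ ≤ ∫ s in t₀..(t₀ + τ), γ ‖u s‖ :=
      intervalIntegral.integral_mono_interval le_rfl ht.1 ht.2 (ae_of_all _ hγpos) hγint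
    have h4 : κ * (∫ s in t₀..t, γ ‖u s‖) ≤ κ * (δ / (2 * κ * Real.exp (L * τ))) :=
      mul_le_mul_of_nonneg_left (h3.trans hen) hκ0.le
    have h5 : (t - t₀) * ε ≤ ε * τ := by
      rw [mul_comm]
      exact mul_le_mul_of_nonneg_left (by linarith [ht.2]) hε0.le
    linarith
  have := le_mul_exp_of_le_add_integral hle hL0 hcw key (t₀ + τ) (right_mem_Icc.2 hle)
  refine this.trans (le_of_eq ?_)
  rw [hε, add_sub_cancel_left]
  field_simp
  norm_num

end Perturbation

section Attractivity

theorem PosDefFun.nonneg {α₃ : ℝ → ℝ} (h : PosDefFun α₃) {s : ℝ} (hs : 0 ≤ s) : 0 ≤ α₃ s := by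
  rcases hs.eq_or_lt with rfl | hs
  · rw [h.2.1]
  · exact (h.2.2 s hs).le

theorem PosDefFun.exists_sq_le {α₃ : ℝ → ℝ} (h : PosDefFun α₃) {η : ℝ} (hη : 0 < η) (M : ℝ) :
    ∃ C, 0 < C ∧ ∀ s ∈ Icc 0 M, s ^ 2 ≤ η + C * α₃ s := by
  let K : Set ℝ := Icc 0 M ∩ {s | η ≤ s ^ 2}
  have hK : IsCompact K := isCompact_Icc.inter_right (isClosed_le (by fun_prop) (by fun_prop))
  have hpos : ∀ s ∈ K, 0 < α₃ s := by
    rintro s ⟨hs, hs2⟩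
    refine h.2.2 s (hs.1.lt_of_ne fun h0 => ?_)
    rw [← h0] at hs2
    exact absurd hs2 (by simpa using hη)
  have hcont : ContinuousOn (fun s => s ^ 2 / α₃ s) K :=
    (by fun_prop : ContinuousOn (fun s : ℝ => s ^ 2) K).div
      (h.1.mono fun s hs => hs.1.1) fun s hs => (hpos s hs).ne'
  obtain ⟨C, hC⟩ := hK.exists_bound_of_continuousOn hcont
  refine ⟨max C 1, by positivity, fun s hs => ?_⟩
  have h0 := h.nonneg hs.1
  rcases le_total (s ^ 2) η with hle | hle
  · have : 0 ≤ max C 1 * α₃ s := by positivity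
    linarith
  · have hsK : s ∈ K := ⟨hs, hle⟩
    have h1 := (le_abs_self _).trans (hC s hsK)
    rw [div_le_iff₀ (hpos s hsK)] at h1
    have h2 : C * α₃ s ≤ max C 1 * α₃ s := mul_le_mul_of_nonneg_right (le_max_left _ _) h0
    linarith

variable [BorelSpace E] [ProperSpace E] [BorelSpace F] [SecondCountableTopology F]
  {f : ℝ → E → F → Γ → E} {S : Set (ℝ → Γ)} {γ φ₁ φ₂ α : ℝ → ℝ}

/-- Persistent excitation yields a uniform lower bound for the dissipated output energy along
zero-input solutions evolving in an annulus. -/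
theorem OutputPE.exists_dissipation [BorelSpace P] {h : ℝ → E → F → Γ → P} {α₃ : ℝ → ℝ}
    (hPE : OutputPE f h S) (hh : OutputRegular h) (hα₃ : PosDefFun α₃)
    (hS : ∀ σ ∈ S, IsSwitchingSignal σ) {ε : ℝ} (hε : 0 < ε) (hε1 : ε ≤ 1) :
    ∃ T, 0 < T ∧ ∃ c, 0 < c ∧ ∀ t₀, 0 ≤ t₀ → ∀ σ ∈ S, ∀ D x,
      IsMaximalSolution f (fun _ => (0 : F)) σ D x → t₀ ∈ D →
        ∀ t, t₀ ≤ t → Icc t (t + T) ⊆ D →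
          (∀ τ ∈ Icc t (t + T), ε ≤ ‖x τ‖ ∧ ‖x τ‖ ≤ 1 / ε) →
            c ≤ ∫ τ in t..(t + T), α₃ ‖h τ (x τ) 0 (σ τ)‖ := by
  obtain ⟨T, hT, r, hr, hPE⟩ := hPE ε hε hε1
  let K : Set E := Metric.closedBall 0 (1 / ε) ∩ {ξ | ε ≤ ‖ξ‖}
  have hK : IsCompact K :=
    (isCompact_closedBall _ _).inter_right (isClosed_le continuous_const continuous_norm)
  obtain ⟨M, hM⟩ := hh.2.2 K hK fun h0 => absurd h0.2 (by simpa using hε)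
  obtain ⟨C, hC0, hC⟩ := hα₃.exists_sq_le (show 0 < r / (2 * T) by positivity) M
  obtain ⟨B, hB⟩ := (isCompact_Icc (a := (0 : ℝ)) (b := M)).exists_bound_of_continuousOn
    (hα₃.1.mono Icc_subset_Ici_self)
  refine ⟨T, hT, r / (2 * C), by positivity, ?_⟩
  intro t₀ ht₀ σ hσ D x hx ht₀D t ht hD hann
  have hPE' := hPE t₀ ht₀ σ hσ D x hx ht₀D t ht hD hann
  have hle : t ≤ t + T := by linarith
  have hI0 : Icc t (t + T) ⊆ Ici (0 : ℝ) := fun s hs => ht₀.trans (ht.trans hs.1)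
  have hmeas : AEMeasurable (fun s => h s (x s) 0 (σ s)) (volume.restrict (Icc t (t + T))) :=
    (hS σ hσ).aemeasurable_comp (v := fun _ => (0 : F)) hh.1 hh.2.1 measurableSet_Icc hI0
      ((hx.1.continuousOn.mono hD).aemeasurable measurableSet_Icc) measurable_const
  have hbd : ∀ᵐ s ∂volume, s ∈ Icc t (t + T) → ‖h s (x s) 0 (σ s)‖ ∈ Icc 0 M := by
    filter_upwards [hM] with s hs hsI
    exact ⟨norm_nonneg _, hs (hI0 hsI) (x s)
      ⟨by simpa using (hann s hsI).2, (hann s hsI).1⟩ (σ s)⟩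
  have hi2 : IntervalIntegrable (fun s => ‖h s (x s) 0 (σ s)‖ ^ 2) volume t (t + T) := by
    refine intervalIntegrable_of_ae_norm_le (C := M ^ 2) hle
      (hmeas.norm.pow_const 2).aestronglyMeasurable ?_
    filter_upwards [hbd] with s hs hsI
    rw [norm_pow, norm_norm]
    exact pow_le_pow_left₀ (hs hsI).1 (hs hsI).2 2
  have hi3 : IntervalIntegrable (fun s => α₃ ‖h s (x s) 0 (σ s)‖) volume t (t + T) := by
    refine intervalIntegrable_of_ae_norm_le (C := B) hle
      (aemeasurable_comp_norm hα₃.1 hmeas).aestronglyMeasurable ?_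
    filter_upwards [hbd] with s hs hsI
    exact hB _ (hs hsI)
  have hc : IntervalIntegrable (fun _ : ℝ => r / (2 * T)) volume t (t + T) := by simp
  have hmono := intervalIntegral.integral_mono_ae_restrict hle hi2 (hc.add (hi3.const_mul C))
    ((ae_restrict_iff' measurableSet_Icc).2 (hbd.mono fun s hs hsI => hC _ (hs hsI)))
  rw [intervalIntegral.integral_add hc (hi3.const_mul C), intervalIntegral.integral_const,
    intervalIntegral.integral_const_mul, smul_eq_mul, add_sub_cancel_left] at hmono
  have hTr : T * (r / (2 * T)) = r / 2 := by field_simp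
  rw [hTr] at hmono
  rw [div_le_iff₀ (by positivity)]
  linarith

/-- The growth estimate `φ₁ ‖x t‖ ≤ φ₂ ‖x t₀‖ + ∫ α ‖u‖` along all solutions. -/
def GrowthEstimate (f : ℝ → E → F → Γ → E) (S : Set (ℝ → Γ)) (φ₁ φ₂ α : ℝ → ℝ) : Prop :=
  ∀ t₀, 0 ≤ t₀ → ∀ u : ℝ → F, IsInput u → ∀ σ ∈ S, ∀ D x,
    IsMaximalSolution f u σ D x → t₀ ∈ D → ∀ t ∈ D, t₀ ≤ t →
      φ₁ ‖x t‖ ≤ φ₂ ‖x t₀‖ + ∫ s in t₀..t, α ‖u s‖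

theorem GrowthEstimate.forwardComplete (hV : GrowthEstimate f S φ₁ φ₂ α) (hreg : Regular f)
    (hA : AssumptionA f γ) (hS : ∀ σ ∈ S, IsSwitchingSignal σ) (hφ₁ : ClassKInf φ₁)
    (hα : ClassK α) : ForwardComplete f S := by
  intro t₀ ht₀ u hu σ hσ D x hx ht₀D
  refine hx.Ici_subset hreg hA.1 hA.2.1 (hS σ hσ) hu ht₀D fun T => ?_
  obtain ⟨R, hR, hle⟩ := hφ₁.exists_ge (φ₂ ‖x t₀‖ + ∫ s in t₀..T, α ‖u s‖)
  refine ⟨R, fun t ht h₀ hT => hφ₁.1.le_of_le (norm_nonneg _) hR.le (le_trans ?_ hle)⟩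
  refine (hV t₀ ht₀ u hu σ hσ D x hx ht₀D t ht h₀).trans (add_le_add le_rfl ?_)
  exact intervalIntegral.integral_mono_interval le_rfl h₀ hT
    (ae_of_all _ fun s => hα.nonneg (norm_nonneg _))
    (hu.intervalIntegrable hα.1 ht₀ (h₀.trans hT))

theorem GrowthEstimate.zero_input (hV : GrowthEstimate f S φ₁ φ₂ α) (hα : ClassK α) {t₀ t : ℝ}
    (ht₀ : 0 ≤ t₀) {σ : ℝ → Γ} (hσ : σ ∈ S) {D : Set ℝ} {x : ℝ → E}
    (hx : IsMaximalSolution f (fun _ => (0 : F)) σ D x) (ht₀D : t₀ ∈ D) (ht : t ∈ D)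
    (hle : t₀ ≤ t) : φ₁ ‖x t‖ ≤ φ₂ ‖x t₀‖ := by
  simpa [hα.2.2] using hV t₀ ht₀ _ isInput_zero σ hσ D x hx ht₀D t ht hle

/-- Uniform attractivity of the origin under zero input. -/
def ZeroInputAttractive (f : ℝ → E → F → Γ → E) (S : Set (ℝ → Γ)) : Prop :=
  ∀ R, 0 < R → ∀ δ, 0 < δ → ∃ τ, 0 < τ ∧ ∀ t₀, 0 ≤ t₀ → ∀ σ ∈ S, ∀ D x,
    IsMaximalSolution f (fun _ => (0 : F)) σ D x → Ici t₀ ⊆ D → ‖x t₀‖ ≤ R →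
      ‖x (t₀ + τ)‖ ≤ δ

/-- Exhibits the comparison functions of the growth estimate together with zero-input uniform
attractivity. -/
theorem HOD.exists_growthEstimate [BorelSpace P] {h : ℝ → E → F → Γ → P}
    (hHOD : HOD f h S α) (hPE : OutputPE f h S) (hh : OutputRegular h)
    (hS : ∀ σ ∈ S, IsSwitchingSignal σ) (hα : ClassK α) :
    ∃ φ₁ φ₂, ClassKInf φ₁ ∧ ClassKInf φ₂ ∧ GrowthEstimate f S φ₁ φ₂ α ∧
      ZeroInputAttractive f S := by
  obtain ⟨V, hV0, ⟨φ₁, φ₂, hφ₁, hφ₂, hVb⟩, α₃, hα₃, hdiss⟩ := hHOD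
  have hgrow : GrowthEstimate f S φ₁ φ₂ α := by
    intro t₀ ht₀ u hu σ hσ D x hx ht₀D t ht hle
    have h1 := hdiss t₀ ht₀ u hu σ hσ D x hx ht₀D t ht hle
    have h2 : 0 ≤ ∫ s in t₀..t, α₃ ‖h s (x s) (u s) (σ s)‖ :=
      intervalIntegral.integral_nonneg hle fun s _ => hα₃.nonneg (norm_nonneg _)
    have h3 := (hVb t (ht₀.trans hle) (x t)).1
    have h4 := (hVb t₀ ht₀ (x t₀)).2
    linarith
  refine ⟨φ₁, φ₂, hφ₁, hφ₂, hgrow, fun R hR δ hδ => ?_⟩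
  obtain ⟨δ', hδ', hδφ⟩ := hφ₂.1.exists_lt (hφ₁.1.pos hδ)
  obtain ⟨R', hR', hRφ⟩ := hφ₁.exists_ge (φ₂ R)
  obtain ⟨T, hT, c, hc, hdec⟩ := hPE.exists_dissipation hh hα₃ hS
    (ε := min 1 (min δ' (1 / R'))) (by positivity) (min_le_left _ _)
  set ε := min 1 (min δ' (1 / R')) with hε
  have hε0 : 0 < ε := by positivity
  have hεδ : ε ≤ δ' := (min_le_right _ _).trans (min_le_left _ _)
  have hεR : R' ≤ 1 / ε := by
    rw [le_one_div hR' hε0]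
    exact (min_le_right _ _).trans (min_le_right _ _)
  obtain ⟨k, hk⟩ := exists_nat_gt (φ₂ R / c)
  rw [div_lt_iff₀ hc] at hk
  have hk0 : 0 < k := by
    rcases Nat.eq_zero_or_pos k with rfl | h0
    · have := hφ₂.1.nonneg hR.le
      simp only [Nat.cast_zero, zero_mul] at hk
      linarith
    · exact h0
  refine ⟨k * T, by positivity, fun t₀ ht₀ σ hσ D x hx hD hxR => ?_⟩
  have ht₀D : t₀ ∈ D := hD self_mem_Ici
  have hbound : ∀ t, t₀ ≤ t → ‖x t‖ ≤ R' := fun t ht =>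
    hφ₁.1.le_of_le (norm_nonneg _) hR'.le
      ((hgrow.zero_input hα ht₀ hσ hx ht₀D (hD ht) ht).trans
        ((hφ₂.1.mono (norm_nonneg _) hxR).trans hRφ))
  by_contra hcon
  have hlow : ∀ t, t₀ ≤ t → t ≤ t₀ + k * T → δ' ≤ ‖x t‖ := by
    intro t ht htk
    by_contra hlt
    refine hcon (hφ₁.1.le_of_le (norm_nonneg _) hδ.le ?_)
    have hend : t₀ ≤ t₀ + k * T := ht.trans htk
    exact (hgrow.zero_input hα (ht₀.trans ht) hσ hx (hD ht) (hD hend) htk).trans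
      ((hφ₂.1.mono (norm_nonneg _) (not_le.1 hlt).le).trans hδφ.le)
  have hstep : ∀ j : ℕ, j ≤ k → V (t₀ + j * T) (x (t₀ + j * T)) ≤ φ₂ R - j * c := by
    intro j
    induction j with
    | zero =>
      intro _
      simp only [Nat.cast_zero, zero_mul, add_zero, sub_zero]
      exact (hVb t₀ ht₀ (x t₀)).2.trans (hφ₂.1.mono (norm_nonneg _) hxR)
    | succ j ih =>
      intro hj
      have ih := ih (by omega)
      have hjT : 0 ≤ (j : ℝ) * T := by positivity
      have hjk : ((j + 1 : ℕ) : ℝ) * T ≤ k * T :=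
        mul_le_mul_of_nonneg_right (by exact_mod_cast hj) hT.le
      push_cast at hjk ⊢
      set s := t₀ + j * T with hs
      have hsn : t₀ + (j + 1) * T = s + T := by
        rw [hs]
        ring
      have hs₀ : t₀ ≤ s := by linarith
      have hsub : Icc s (s + T) ⊆ D := fun q hq => hD (hs₀.trans hq.1)
      have h1 := hdec t₀ ht₀ σ hσ D x hx ht₀D s hs₀ hsub fun q hq =>
        ⟨hεδ.trans (hlow q (hs₀.trans hq.1) (by linarith [hq.2])),
          (hbound q (hs₀.trans hq.1)).trans hεR⟩
      have h2 := hdiss s (ht₀.trans hs₀) _ isInput_zero σ hσ D x hx (hD hs₀) (s + T)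
        (hsub ⟨by linarith, le_rfl⟩) (by linarith)
      simp only [norm_zero, hα.2.2, intervalIntegral.integral_zero, add_zero] at h2
      rw [hsn]
      linarith
  have := hstep k le_rfl
  linarith [hV0 (t₀ + k * T) (x (t₀ + k * T))]

/-- Uniform attractivity up to the energy of the input. -/
theorem GrowthEstimate.exists_settling_time (hV : GrowthEstimate f S φ₁ φ₂ α)
    (h0 : ZeroInputAttractive f S) (hreg : Regular f) (hA : AssumptionA f γ)
    (hS : ∀ σ ∈ S, IsSwitchingSignal σ) (hφ₁ : ClassKInf φ₁) (hφ₂ : ClassKInf φ₂)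
    (hα : ClassK α) {χ : ℝ → ℝ} (hχ : ContinuousOn χ (Ici 0)) (hαχ : ∀ s, α s ≤ χ s)
    (hγχ : ∀ s, γ s ≤ χ s) {r ε : ℝ} (hε : 0 < ε) :
    ∃ T, ∀ t₀, 0 ≤ t₀ → ∀ u : ℝ → F, IsInput u → ∀ σ ∈ S, ∀ D x,
      IsMaximalSolution f u σ D x → t₀ ∈ D → ∀ t, t₀ ≤ t → t₀ + T ≤ t → ‖x t₀‖ ≤ r →
        (∫ s in t₀..t, χ ‖u s‖) ≤ r → φ₁ ‖x t‖ ≤ ε + ∫ s in t₀..t, χ ‖u s‖ := by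
  have hfc := hV.forwardComplete hreg hA hS hφ₁ hα
  have hχ0 : ∀ v : F, 0 ≤ χ ‖v‖ := fun v => (hα.nonneg (norm_nonneg v)).trans (hαχ _)
  obtain ⟨δ, hδ, hδφ⟩ := hφ₂.1.exists_lt hε
  obtain ⟨R, hR, hRφ⟩ := hφ₁.exists_ge (φ₂ r + r)
  obtain ⟨R', hR', hRφ'⟩ := hφ₁.exists_ge (φ₂ R)
  obtain ⟨τ, hτ, hattr⟩ := h0 R hR (δ / 2) (by positivity)
  obtain ⟨e, he, hpert⟩ := hA.exists_energy_bound (R := max R R') (lt_max_of_lt_left hR) hτ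
    (show 0 < δ / 2 by positivity)
  obtain ⟨k, hk⟩ := exists_nat_gt (r / e)
  rw [div_lt_iff₀ he] at hk
  refine ⟨k * τ, fun t₀ ht₀ u hu σ hσ D x hx ht₀D t ht hTt hxr hen => ?_⟩
  have hD : Ici t₀ ⊆ D := hfc t₀ ht₀ u hu σ hσ D x hx ht₀D
  have hint : ∀ a b, t₀ ≤ a → a ≤ b → IntervalIntegrable (fun s => χ ‖u s‖) volume a b :=
    fun a b ha hab => hu.intervalIntegrable hχ (ht₀.trans ha) hab
  have hsubint : ∀ a b, t₀ ≤ a → a ≤ b → b ≤ t →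
      ∫ s in a..b, χ ‖u s‖ ≤ ∫ s in t₀..t, χ ‖u s‖ := fun a b ha hab hb =>
    intervalIntegral.integral_mono_interval ha hab hb (ae_of_all _ fun s => hχ0 _)
      (hint t₀ t le_rfl ht)
  have hαint : ∀ a b, t₀ ≤ a → a ≤ b → ∫ s in a..b, α ‖u s‖ ≤ ∫ s in a..b, χ ‖u s‖ :=
    fun a b ha hab => intervalIntegral.integral_mono_on hab
      (hu.intervalIntegrable hα.1 (ht₀.trans ha) hab) (hint a b ha hab) fun s _ => hαχ _
  have hxR : ∀ s, t₀ ≤ s → s ≤ t → ‖x s‖ ≤ R := by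
    intro s hs hst
    refine hφ₁.1.le_of_le (norm_nonneg _) hR.le (le_trans ?_ hRφ)
    refine (hV t₀ ht₀ u hu σ hσ D x hx ht₀D s (hD hs) hs).trans
      (add_le_add (hφ₂.1.mono (norm_nonneg _) hxr) ?_)
    exact (hαint t₀ s le_rfl hs).trans ((hsubint t₀ s le_rfl hs hst).trans hen)
  have hpigeon : ∃ j : ℕ, j < k ∧
      ∫ s in (t₀ + j * τ)..(t₀ + j * τ + τ), χ ‖u s‖ ≤ e := by
    by_contra hcon
    push Not at hcon
    have hsum : ∀ j : ℕ, j ≤ k → j * e ≤ ∫ s in t₀..(t₀ + j * τ), χ ‖u s‖ := by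
      intro j
      induction j with
      | zero => simp
      | succ j ih =>
        intro hj
        have h1 := ih (by omega)
        have h2 := hcon j (by omega)
        have hjτ : 0 ≤ (j : ℝ) * τ := by positivity
        have h3 := intervalIntegral.integral_add_adjacent_intervals
          (hint t₀ (t₀ + j * τ) le_rfl (by linarith))
          (hint (t₀ + j * τ) (t₀ + j * τ + τ) (by linarith) (by linarith))
        have h4 : t₀ + ((j + 1 : ℕ) : ℝ) * τ = t₀ + j * τ + τ := by
          push_cast
          ring
        rw [h4, ← h3]
        push_cast
        linarith
    have hkτ : 0 ≤ (k : ℝ) * τ := by positivity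
    linarith [hsum k le_rfl, hsubint t₀ (t₀ + k * τ) le_rfl (by linarith) hTt]
  obtain ⟨j, hjk, hj⟩ := hpigeon
  have hjτ : 0 ≤ (j : ℝ) * τ := by positivity
  have hjk' : (j + 1 : ℝ) * τ ≤ k * τ :=
    mul_le_mul_of_nonneg_right (by exact_mod_cast hjk) hτ.le
  set s₀ := t₀ + j * τ with hs₀
  have hs₀t₀ : t₀ ≤ s₀ := by linarith
  have hs₁t : s₀ + τ ≤ t := by linarith
  have hs₀0 : 0 ≤ s₀ := ht₀.trans hs₀t₀
  obtain ⟨b, hb, y₀, hy₀, hysol⟩ := exists_local_solution hreg hA.1 hA.2.1 (hS σ hσ)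
    (isInput_zero (F := F)) hs₀0 (x s₀)
  obtain ⟨D', y, hy, hDD', hyy⟩ := hysol.exists_maximal
  have hs₀b : s₀ ∈ Icc s₀ b := left_mem_Icc.2 hb.le
  have hys₀ : x s₀ = y s₀ := by rw [← hyy hs₀b, hy₀]
  have hD' : Ici s₀ ⊆ D' := hfc s₀ hs₀0 _ isInput_zero σ hσ D' y hy (hDD' hs₀b)
  have hyR : ‖y s₀‖ ≤ R := hys₀ ▸ hxR s₀ hs₀t₀ (by linarith)
  have hyR' : ∀ s, s₀ ≤ s → ‖y s‖ ≤ R' := fun s hs =>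
    hφ₁.1.le_of_le (norm_nonneg _) hR'.le
      ((hV.zero_input hα hs₀0 hσ hy (hDD' hs₀b) (hD' hs) hs).trans
        ((hφ₂.1.mono (norm_nonneg _) hyR).trans hRφ'))
  have hγe : ∫ s in s₀..(s₀ + τ), γ ‖u s‖ ≤ e :=
    (intervalIntegral.integral_mono_on (by linarith)
      (hu.intervalIntegrable hA.1.1 hs₀0 (by linarith))
      (hint s₀ (s₀ + τ) hs₀t₀ (by linarith)) fun s _ => hγχ _).trans hj
  have hdist := hpert s₀ u σ D D' x y hu hx.1 hy.1 (fun s hs => hD (hs₀t₀.trans hs.1))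
    (fun s hs => hD' hs.1) hys₀
    (fun s hs => (hxR s (hs₀t₀.trans hs.1) (hs.2.trans hs₁t)).trans (le_max_left _ _))
    (fun s hs => (hyR' s hs.1).trans (le_max_right _ _)) hγe
  have hyδ := hattr s₀ hs₀0 σ hσ D' y hy hD' hyR
  have hxδ : ‖x (s₀ + τ)‖ ≤ δ := by
    have := norm_sub_norm_le (x (s₀ + τ)) (y (s₀ + τ))
    linarith
  have hs₁ : t₀ ≤ s₀ + τ := by linarith
  have h1 := hV (s₀ + τ) (ht₀.trans hs₁) u hu σ hσ D x hx (hD hs₁) t (hD ht) hs₁t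
  have h2 := hφ₂.1.mono (norm_nonneg _) hxδ
  have h3 := (hαint (s₀ + τ) t hs₁ hs₁t).trans (hsubint (s₀ + τ) t hs₁ hs₁t le_rfl)
  linarith

end Attractivity

section

variable [BorelSpace E] [ProperSpace E] [BorelSpace F] [SecondCountableTopology F]
  {f : ℝ → E → F → Γ → E} {S : Set (ℝ → Γ)} {φ₁ φ₂ α γ χ : ℝ → ℝ}

theorem ClassKL.comp_left {ψ : ℝ → ℝ} {b : ℝ → ℝ → ℝ} (hψ : ClassKInf ψ) (hb : ClassKL b) :
    ClassKL fun r s => ψ (b r s) := by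
  refine ⟨fun t ht => hψ.comp (hb.1 t ht), fun r hr => ⟨fun s hs t ht hst => ?_, ?_⟩⟩
  · exact hψ.1.mono ((hb.1 t ht).1.nonneg hr) ((hb.2 r hr).1 hs ht hst)
  · refine hψ.1.tendsto_zero.comp (tendsto_nhdsWithin_iff.2 ⟨(hb.2 r hr).2, ?_⟩)
    filter_upwards [eventually_ge_atTop 0] with s hs
    exact (hb.1 s hs).1.nonneg hr

theorem GrowthEstimate.iISS (hV : GrowthEstimate f S φ₁ φ₂ α) (h0 : ZeroInputAttractive f S)
    (hreg : Regular f) (hA : AssumptionA f γ) (hS : ∀ σ ∈ S, IsSwitchingSignal σ)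
    (hφ₁ : ClassKInf φ₁) (hφ₂ : ClassKInf φ₂) (hα : ClassK α) (hχ : ContinuousOn χ (Ici 0))
    (hαχ : ∀ s, α s ≤ χ s) (hγχ : ∀ s, γ s ≤ χ s) : IISS f S χ := by
  have hfc := hV.forwardComplete hreg hA hS hφ₁ hα
  have hχ0 : ∀ v : F, 0 ≤ χ ‖v‖ := fun v => (hα.nonneg (norm_nonneg v)).trans (hαχ _)
  have hgrow : ∀ t₀, 0 ≤ t₀ → ∀ u : ℝ → F, IsInput u → ∀ σ ∈ S, ∀ D x,
      IsMaximalSolution f u σ D x → t₀ ∈ D → ∀ t, t₀ ≤ t →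
        φ₁ ‖x t‖ ≤ φ₂ ‖x t₀‖ + ∫ s in t₀..t, χ ‖u s‖ := by
    intro t₀ ht₀ u hu σ hσ D x hx ht₀D t ht
    refine (hV t₀ ht₀ u hu σ hσ D x hx ht₀D t
      (hfc t₀ ht₀ u hu σ hσ D x hx ht₀D ht) ht).trans (add_le_add le_rfl ?_)
    exact intervalIntegral.integral_mono_on ht (hu.intervalIntegrable hα.1 ht₀ ht)
      (hu.intervalIntegrable hχ ht₀ ht) fun s _ => hαχ _
  let B : ℝ → ℝ → Set ℝ := fun r s => {w | ∃ t₀, 0 ≤ t₀ ∧ ∃ u : ℝ → F, IsInput u ∧ ∃ σ ∈ S,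
    ∃ D x, IsMaximalSolution f u σ D x ∧ t₀ ∈ D ∧ ∃ t, t₀ ≤ t ∧ t₀ + s ≤ t ∧ ‖x t₀‖ ≤ r ∧
      (∫ s in t₀..t, χ ‖u s‖) ≤ r ∧ w = φ₁ ‖x t‖ - ∫ s in t₀..t, χ ‖u s‖}
  obtain ⟨b, hb, hBb⟩ : ∃ b, ClassKL b ∧ ∀ r, 0 ≤ r → ∀ s, ∀ w ∈ B r s, w ≤ b r s := by
    refine exists_classKL_bound ?_ hφ₂.1 ?_ ?_
    · rintro r r' s s' hr hs w ⟨t₀, ht₀, u, hu, σ, hσ, D, x, hx, hD, t, ht, hts, hxr, hur, rfl⟩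
      exact ⟨t₀, ht₀, u, hu, σ, hσ, D, x, hx, hD, t, ht, by linarith, hxr.trans hr,
        hur.trans hr, rfl⟩
    · rintro r hr s w ⟨t₀, ht₀, u, hu, σ, hσ, D, x, hx, hD, t, ht, hts, hxr, hur, rfl⟩
      have h1 := hgrow t₀ ht₀ u hu σ hσ D x hx hD t ht
      have h2 := hφ₂.1.mono (norm_nonneg _) hxr
      linarith
    · intro r hr ε hε
      obtain ⟨T, hT⟩ := hV.exists_settling_time h0 hreg hA hS hφ₁ hφ₂ hα hχ hαχ hγχ
        (r := r) hε
      refine ⟨T, ?_⟩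
      rintro w ⟨t₀, ht₀, u, hu, σ, hσ, D, x, hx, hD, t, ht, hts, hxr, hur, rfl⟩
      have := hT t₀ ht₀ u hu σ hσ D x hx hD t ht hts hxr hur
      linarith
  obtain ⟨ψ, hψ, hψφ⟩ := hφ₁.exists_inverse
  have hψ2 := hψ.comp classKInf_two_mul
  refine ⟨hfc, fun r s => ψ (2 * b r s), fun e => ψ (2 * (φ₂ e + e)),
    ClassKL.comp_left (ψ := fun s => ψ (2 * s)) hψ2 hb,
    (hψ2.comp hφ₂.add_id).1, ?_⟩
  intro t₀ ht₀ u hu σ hσ D x hx hD t htD ht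
  set e := ∫ s in t₀..t, χ ‖u s‖ with he
  have he0 : 0 ≤ e := intervalIntegral.integral_nonneg ht fun s _ => hχ0 _
  have hb0 : 0 ≤ b ‖x t₀‖ (t - t₀) := (hb.1 _ (sub_nonneg.2 ht)).1.nonneg (norm_nonneg _)
  have hφe : 0 ≤ φ₂ e := hφ₂.1.nonneg he0
  have hmain : φ₁ ‖x t‖ ≤ b ‖x t₀‖ (t - t₀) + (φ₂ e + e) := by
    rcases le_total e ‖x t₀‖ with hle | hle
    · have := hBb ‖x t₀‖ (norm_nonneg _) (t - t₀) _
        ⟨t₀, ht₀, u, hu, σ, hσ, D, x, hx, hD, t, ht, by linarith, le_rfl, hle, rfl⟩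
      linarith
    · have h1 := hgrow t₀ ht₀ u hu σ hσ D x hx hD t ht
      have h2 := hφ₂.1.mono (norm_nonneg _) hle
      linarith
  have hφ0 : 0 ≤ φ₁ ‖x t‖ := hφ₁.1.nonneg (norm_nonneg _)
  have hψb : 0 ≤ ψ (2 * b ‖x t₀‖ (t - t₀)) := hψ.1.nonneg (by positivity)
  have hψe : 0 ≤ ψ (2 * (φ₂ e + e)) := hψ.1.nonneg (by positivity)
  rw [← hψφ ‖x t‖ (norm_nonneg _)]
  rcases le_total (b ‖x t₀‖ (t - t₀)) (φ₂ e + e) with hle | hle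
  · have : ψ (φ₁ ‖x t‖) ≤ ψ (2 * (φ₂ e + e)) := hψ.1.mono hφ0 (by linarith)
    linarith
  · have : ψ (φ₁ ‖x t‖) ≤ ψ (2 * b ‖x t₀‖ (t - t₀)) := hψ.1.mono hφ0 (by linarith)
    linarith

theorem IISS.bEICS (h : IISS f S χ) (hχ : ContinuousOn χ (Ici 0)) (hχ0 : ∀ s, 0 ≤ s → 0 ≤ χ s) :
    BEICS f S χ := by
  obtain ⟨hfc, β, ρ, hβ, hρ, hbound⟩ := h
  intro t₀ ht₀ u hu σ hσ D x hx hD hE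
  have hsub := hfc t₀ ht₀ u hu σ hσ D x hx hD
  refine ⟨hsub, ?_⟩
  have hint : IntegrableOn (fun s => χ ‖u s‖) (Ioi 0) := by
    refine ⟨(aemeasurable_comp_norm hχ hu.1.aemeasurable).aestronglyMeasurable, ?_⟩
    rw [hasFiniteIntegral_iff_ofReal (ae_of_all _ fun s => hχ0 _ (norm_nonneg _))]
    exact lt_top_iff_ne_top.2 hE
  rw [Metric.tendsto_atTop]
  intro ε hε
  obtain ⟨e, he, hρe⟩ := hρ.exists_lt (half_pos hε)
  obtain ⟨t₁, ht₁, ht₀₁, htail⟩ : ∃ t₁, 0 ≤ t₁ ∧ t₀ ≤ t₁ ∧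
      ∀ t, t₁ ≤ t → (∫ s in t₁..t, χ ‖u s‖) ≤ e := by
    have hlim := intervalIntegral_tendsto_integral_Ioi 0 hint tendsto_id
    obtain ⟨a, ha⟩ := Metric.tendsto_atTop.1 hlim (e / 2) (half_pos he)
    refine ⟨max a t₀, ht₀.trans (le_max_right _ _), le_max_right _ _, fun t ht => ?_⟩
    have hm : 0 ≤ max a t₀ := ht₀.trans (le_max_right _ _)
    have h1 := abs_lt.1 (ha (max a t₀) (le_max_left _ _))
    have h2 := abs_lt.1 (ha t ((le_max_left _ _).trans ht))
    have h3 := intervalIntegral.integral_add_adjacent_intervals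
      (hu.intervalIntegrable hχ le_rfl hm) (hu.intervalIntegrable hχ hm ht)
    simp only [id] at h1 h2
    linarith [h1.1, h2.2]
  have hβ0 : Tendsto (fun t => β ‖x t₁‖ (t - t₁)) atTop (𝓝 0) :=
    (hβ.2 _ (norm_nonneg _)).2.comp (tendsto_atTop_add_const_right _ _ tendsto_id)
  obtain ⟨t₂, ht₂⟩ := eventually_atTop.1 (hβ0.eventually_lt_const (half_pos hε))
  refine ⟨max t₁ t₂, fun t ht => ?_⟩
  have ht1 : t₁ ≤ t := (le_max_left _ _).trans ht
  have h1 := hbound t₁ ht₁ u hu σ hσ D x hx (hsub ht₀₁) t (hsub (ht₀₁.trans ht1)) ht1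
  have h2 := ht₂ t ((le_max_right _ _).trans ht)
  have h3 := hρ.mono (intervalIntegral.integral_nonneg ht1
    fun s _ => hχ0 _ (norm_nonneg (u s))) (htail t ht1)
  rw [dist_zero_right]
  linarith

end

/-- Theorem 2(b): under Assumption A with `γ` as in (C1), if there is an
output map `h` such that the system is `h`-OD w.r.t. `S` with supply function `α` and the
pair `(h, f)` is zero-input output-PE w.r.t. `S`, then the system is iISS w.r.t. `S` with
iISS gain `χ = max {α, γ}` and has the `χ`-BEICS property w.r.t. `S`. -/
theorem stmt13 {n m p : ℕ} {Γ : Type*} [Nonempty Γ]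
    (f : ℝ → EuclideanSpace ℝ (Fin n) → EuclideanSpace ℝ (Fin m) → Γ → EuclideanSpace ℝ (Fin n))
    (h : ℝ → EuclideanSpace ℝ (Fin n) → EuclideanSpace ℝ (Fin m) → Γ → EuclideanSpace ℝ (Fin p))
    (hreg : Regular f) (hhreg : OutputRegular h)
    (S : Set (ℝ → Γ)) (hS : ∀ σ ∈ S, IsSwitchingSignal σ)
    (γ : ℝ → ℝ) (hA : AssumptionA f γ)
    (α : ℝ → ℝ) (hα : ClassK α)
    (hHOD : HOD f h S α) (hPE : OutputPE f h S) :
    IISS f S (fun s => max (α s) (γ s)) ∧ BEICS f S (fun s => max (α s) (γ s)) := by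
  obtain ⟨φ₁, φ₂, hφ₁, hφ₂, hV, h0⟩ := hHOD.exists_growthEstimate hPE hhreg hS hα
  have hχ : ContinuousOn (fun s => max (α s) (γ s)) (Ici 0) := hα.1.sup hA.1.1
  have hiISS := hV.iISS h0 hreg hA hS hφ₁ hφ₂ hα hχ (fun _ => le_max_left _ _)
    fun _ => le_max_right _ _
  exact ⟨hiISS, hiISS.bEICS hχ fun _ hs => (hα.nonneg hs).trans (le_max_left _ _)⟩
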